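/- arXiv:math/0308105 — 6 statements merged into one kernel-verified Lean document; each statement's English description precedes it below -/
import Mathlib

section
/- For every odd integer n with n = 5 or n ≥ 7, every graphical sequence S of n nonnegative integers with sum σ(S) ≥ 3n − 1 has a realization containing K₄−e as a subgraph (i.e., S is potentially K₄−e graphical). -/
open scoped Classical

noncomputable section

/-- `H` is contained in `G` as a subgraph: there is an injective map of vertices
carrying edges of `H` to edges of `G`. -/
def ContainsSub {W V : Type*} (G : SimpleGraph V) (H : SimpleGraph W) : Prop :=
  ∃ f : W ↪ V, ∀ a b, H.Adj a b → G.Adj (f a) (f b)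

/-- The graph `K₄ - e`: the complete graph on 4 vertices with the edge `{0,1}` deleted. -/
def K4e : SimpleGraph (Fin 4) :=
  SimpleGraph.fromEdgeSet {s(0,2), s(0,3), s(1,2), s(1,3), s(2,3)}

/-- `G` is a realization of the sequence `S`: the degree sequence of `G` is
precisely `S` (as a multiset, i.e. up to reordering). -/
def IsRealization {n : ℕ} (S : Fin n → ℕ) (G : SimpleGraph (Fin n)) : Prop :=
  letI : DecidableRel G.Adj := Classical.decRel _
  Multiset.map (fun v => G.degree v) Finset.univ.val = Multiset.map S Finset.univ.val

/-- A sequence of nonnegative integers is graphical if some simple graph realizes it. -/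
def Graphical {n : ℕ} (S : Fin n → ℕ) : Prop :=
  ∃ G : SimpleGraph (Fin n), IsRealization S G


namespace K4eDegree

open SimpleGraph

/-- `G` contains `K₄ - e`, with `a b` the edge joining the two vertices of degree three. -/
def HasK4e {V : Type*} (G : SimpleGraph V) : Prop :=
  ∃ a b c d, c ≠ d ∧ G.Adj a b ∧ G.Adj a c ∧ G.Adj a d ∧ G.Adj b c ∧ G.Adj b d

/-- The degree of a vertex, free of decidability instances. -/
def deg {V : Type*} (G : SimpleGraph V) (x : V) : ℕ := (G.neighborSet x).ncard

/-- Some graph with the same vertex degrees as `G` contains `K₄ - e`. -/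
def Good {V : Type*} (G : SimpleGraph V) : Prop :=
  ∃ H : SimpleGraph V, (∀ x, deg H x = deg G x) ∧ HasK4e H

variable {V : Type*}

/-- The indicator of a vertex. -/
def ind (p x : V) : ℕ := if x = p then 1 else 0

lemma HasK4e.mono {G H : SimpleGraph V} (hle : G ≤ H) (h : HasK4e G) : HasK4e H := by
  obtain ⟨a, b, c, d, hcd, h1, h2, h3, h4, h5⟩ := h
  exact ⟨a, b, c, d, hcd, hle h1, hle h2, hle h3, hle h4, hle h5⟩

lemma HasK4e.good {G : SimpleGraph V} (h : HasK4e G) : Good G := ⟨G, fun _ => rfl, h⟩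

lemma Good.of_deg_eq {G H : SimpleGraph V} (h : ∀ x, deg H x = deg G x) (hH : Good H) :
    Good G := by
  obtain ⟨K, hK, hK'⟩ := hH
  exact ⟨K, fun x => (hK x).trans (h x), hK'⟩

lemma edge_adj_iff {p q x y : V} (h : p ≠ q) :
    (edge p q).Adj x y ↔ (x = p ∧ y = q) ∨ (x = q ∧ y = p) := by
  rw [edge_adj]
  grind

lemma sdiff_edge_adj {G : SimpleGraph V} {p q x y : V} :
    (G \ edge p q).Adj x y ↔ G.Adj x y ∧ ¬((x = p ∧ y = q) ∨ (x = q ∧ y = p)) := by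
  rw [sdiff_adj, edge_adj]
  have := @SimpleGraph.Adj.ne _ G x y
  tauto

lemma sup_edge_adj {G : SimpleGraph V} {p q x y : V} (h : p ≠ q) :
    (G ⊔ edge p q).Adj x y ↔ G.Adj x y ∨ (x = p ∧ y = q) ∨ (x = q ∧ y = p) := by
  rw [sup_adj, edge_adj_iff h]

lemma deg_edge {p q : V} (h : p ≠ q) (x : V) :
    deg (edge p q) x = ind p x + ind q x := by
  unfold deg
  have : (edge p q).neighborSet x = {y | (x = p ∧ y = q) ∨ (x = q ∧ y = p)} := by
    ext y
    exact edge_adj_iff h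
  rw [this]
  by_cases h1 : x = p
  · subst h1
    simp [h, ind]
  · by_cases h2 : x = q
    · subst h2
      simp [h1, ind]
    · simp [h1, h2, ind]

variable [Fintype V]

lemma deg_sup {G H : SimpleGraph V} (h : ∀ x y, G.Adj x y → ¬ H.Adj x y) (x : V) :
    deg (G ⊔ H) x = deg G x + deg H x := by
  unfold deg
  rw [neighborSet_sup, Set.ncard_union_eq _ (Set.toFinite _) (Set.toFinite _)]
  rw [Set.disjoint_left]
  exact h x

lemma deg_sup_edge {G : SimpleGraph V} {p q : V} (h : p ≠ q) (hG : ¬ G.Adj p q) (x : V) :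
    deg (G ⊔ edge p q) x =
      deg G x + (ind p x + ind q x) := by
  rw [deg_sup, deg_edge h]
  intro x y hxy hxy'
  rw [edge_adj_iff h] at hxy'
  have := hxy.symm
  grind

lemma deg_sdiff_edge {G : SimpleGraph V} {p q : V} (hG : G.Adj p q) (x : V) :
    deg (G \ edge p q) x + (ind p x + ind q x) =
      deg G x := by
  rw [← deg_sup_edge hG.ne (by rw [sdiff_edge_adj]; tauto)]
  rw [sdiff_sup_cancel]
  intro x y hxy
  rw [edge_adj_iff hG.ne] at hxy
  have := hG.symm
  grind

/-- Adding an edge. -/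
lemma exists_add {G : SimpleGraph V} {p q : V} (h : p ≠ q) (hG : ¬ G.Adj p q) :
    ∃ H : SimpleGraph V,
      (∀ x, deg H x = deg G x + (ind p x + ind q x)) ∧
      ∀ x y, H.Adj x y ↔ G.Adj x y ∨ (x = p ∧ y = q) ∨ (x = q ∧ y = p) :=
  ⟨G ⊔ edge p q, deg_sup_edge h hG, fun _ _ => sup_edge_adj h⟩

/-- Removing an edge. -/
lemma exists_remove {G : SimpleGraph V} {p q : V} (hG : G.Adj p q) :
    ∃ H : SimpleGraph V,
      (∀ x, deg G x = deg H x + (ind p x + ind q x)) ∧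
      ∀ x y, H.Adj x y ↔ G.Adj x y ∧ ¬((x = p ∧ y = q) ∨ (x = q ∧ y = p)) :=
  ⟨G \ edge p q, fun x => (deg_sdiff_edge hG x).symm, fun _ _ => sdiff_edge_adj⟩

lemma sum_deg_remove {G H : SimpleGraph V} {p q : V}
    (h : ∀ x, deg G x = deg H x + (ind p x + ind q x)) :
    ∑ x, deg G x = ∑ x, deg H x + 2 := by
  rw [Finset.sum_congr rfl fun x _ => h x]
  simp [Finset.sum_add_distrib, ind]

lemma exists_adj_of_sum_deg_pos {G : SimpleGraph V} (h : 0 < ∑ x, deg G x) :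
    ∃ p q, G.Adj p q := by
  by_contra! hG
  have : ∀ x, deg G x = 0 := fun x => by
    unfold deg
    rw [Set.ncard_eq_zero]
    ext y
    simpa using hG x y
  simp [this] at h

lemma not_adj_of_deg_eq_zero {G : SimpleGraph V} {x : V} (h : deg G x = 0) (y : V) :
    ¬ G.Adj x y := by
  unfold deg at h
  rw [Set.ncard_eq_zero] at h
  intro hy
  have : y ∈ G.neighborSet x := hy
  simp [h] at this

lemma exists_two_adj {G : SimpleGraph V} {x : V} (h : 2 ≤ deg G x) :
    ∃ p q, p ≠ q ∧ G.Adj x p ∧ G.Adj x q := by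
  obtain ⟨p, q, hp, hq, hpq⟩ := (Set.one_lt_ncard_iff (Set.toFinite _)).1 h
  exact ⟨p, q, hpq, hp, hq⟩

lemma exists_two_adj_ne {G : SimpleGraph V} {x v : V} (h : 3 ≤ deg G x) (hv : G.Adj x v) :
    ∃ p q, p ≠ q ∧ p ≠ v ∧ q ≠ v ∧ G.Adj x p ∧ G.Adj x q := by
  have h1 := deg_sdiff_edge hv x
  have hne := hv.ne
  simp only [ind, if_true, hne, if_false] at h1
  obtain ⟨p, q, hpq, hp, hq⟩ := exists_two_adj (G := G \ edge x v) (x := x) (by omega)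
  rw [sdiff_edge_adj] at hp hq
  exact ⟨p, q, hpq, by grind, by grind, hp.1, hq.1⟩

/-- Switching the edges `u x`, `w y` to `u w`, `x y`. -/
lemma exists_switch {G : SimpleGraph V} {u w x y : V} (huw : u ≠ w) (hxy : x ≠ y)
    (hux : G.Adj u x) (hwy : G.Adj w y) (nuw : ¬ G.Adj u w) (nxy : ¬ G.Adj x y) :
    ∃ H : SimpleGraph V, (∀ z, deg H z = deg G z) ∧
      ∀ s t, H.Adj s t ↔ (((G.Adj s t ∧ ¬((s = u ∧ t = x) ∨ (s = x ∧ t = u))) ∧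
        ¬((s = w ∧ t = y) ∨ (s = y ∧ t = w))) ∨ ((s = u ∧ t = w) ∨ (s = w ∧ t = u))) ∨
        ((s = x ∧ t = y) ∨ (s = y ∧ t = x)) := by
  obtain ⟨G₁, d₁, a₁⟩ := exists_remove hux
  obtain ⟨G₂, d₂, a₂⟩ := exists_remove (G := G₁) (p := w) (q := y) (by rw [a₁]; grind)
  obtain ⟨G₃, d₃, a₃⟩ := exists_add (G := G₂) huw (by simp only [a₂, a₁]; tauto)
  obtain ⟨G₄, d₄, a₄⟩ := exists_add (G := G₃) hxy (by
    simp only [a₃, a₂, a₁]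
    have := hux.ne
    grind [SimpleGraph.Adj.symm])
  refine ⟨G₄, fun z => ?_, fun s t => ?_⟩
  · linarith [d₁ z, d₂ z, d₃ z, d₄ z]
  · rw [a₄, a₃, a₂, a₁]

/-- The case of two nonadjacent vertices whose neighbourhoods are disjoint and completely joined. -/
lemma good_of_complete_between {G : SimpleGraph V} {u w p q r s : V} (hpq : p ≠ q) (hrs : r ≠ s)
    (huw : ¬ G.Adj u w) (hne : u ≠ w) (hup : G.Adj u p) (huq : G.Adj u q)
    (hwr : G.Adj w r) (hws : G.Adj w s) (hpr : G.Adj p r) (hps : G.Adj p s)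
    (hqr : G.Adj q r) (hqs : G.Adj q s) (hur : ¬ G.Adj u r) : Good G := by
  by_cases npq : G.Adj p q
  · exact HasK4e.good ⟨p, q, r, s, hrs, npq, hpr, hps, hqr, hqs⟩
  have ur : u ≠ r := by rintro rfl; exact huw hwr.symm
  have h1 := hup.ne
  have h2 := huq.ne
  have h3 := hwr.ne
  obtain ⟨G₁, d₁, a₁⟩ := exists_remove hup
  obtain ⟨G₂, d₂, a₂⟩ := exists_remove (G := G₁) (p := w) (q := r) (by rw [a₁]; grind)
  obtain ⟨G₃, d₃, a₃⟩ := exists_remove (G := G₂) (p := u) (q := q) (by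
    simp only [a₂, a₁]; grind)
  obtain ⟨G₄, d₄, a₄⟩ := exists_add (G := G₃) hpq (by simp only [a₃, a₂, a₁]; tauto)
  obtain ⟨G₅, d₅, a₅⟩ := exists_add (G := G₄) ur (by simp only [a₄, a₃, a₂, a₁]; grind)
  obtain ⟨G₆, d₆, a₆⟩ := exists_add (G := G₅) hne (by simp only [a₅, a₄, a₃, a₂, a₁]; grind)
  refine ⟨G₆, fun z => ?_, ?_⟩
  · linarith [d₁ z, d₂ z, d₃ z, d₄ z, d₅ z, d₆ z]
  · have h4 := hws.ne
    have h5 := hpr.ne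
    have h6 := hps.ne
    have h7 := hqr.ne
    have h8 := hqs.ne
    have h9 : p ≠ w := by rintro rfl; exact huw hup
    have h10 : q ≠ w := by rintro rfl; exact huw huq
    have h11 : s ≠ u := by rintro rfl; exact huw hws.symm
    refine ⟨p, q, r, s, hrs, ?_, ?_, ?_, ?_, ?_⟩ <;>
      rw [a₆, a₅, a₄, a₃, a₂, a₁] <;> grind

/-- Two nonadjacent vertices of degree at least two can be made adjacent. -/
lemma good_or_exists_adj {G : SimpleGraph V} {u w : V} (hne : u ≠ w) (hu : 2 ≤ deg G u)
    (hw : 2 ≤ deg G w) :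
    Good G ∨ ∃ H : SimpleGraph V, (∀ z, deg H z = deg G z) ∧ H.Adj u w := by
  by_cases huw : G.Adj u w
  · exact Or.inr ⟨G, fun _ => rfl, huw⟩
  by_cases hs : ∃ x y, x ≠ y ∧ G.Adj u x ∧ G.Adj w y ∧ ¬ G.Adj x y
  · obtain ⟨x, y, hxy, hux, hwy, nxy⟩ := hs
    obtain ⟨H, hH, hadj⟩ := exists_switch hne hxy hux hwy huw nxy
    exact Or.inr ⟨H, hH, by rw [hadj]; exact Or.inl (Or.inr (Or.inl ⟨rfl, rfl⟩))⟩
  left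
  push Not at hs
  by_cases hc : ∃ p, G.Adj u p ∧ G.Adj w p
  · obtain ⟨p, hup, hwp⟩ := hc
    obtain ⟨q, hqp, huq⟩ : ∃ q, q ≠ p ∧ G.Adj u q := by
      obtain ⟨a, b, hab, ha, hb⟩ := exists_two_adj hu
      by_cases h : a = p
      · exact ⟨b, by grind, hb⟩
      · exact ⟨a, h, ha⟩
    obtain ⟨s, hsp, hws⟩ : ∃ s, s ≠ p ∧ G.Adj w s := by
      obtain ⟨a, b, hab, ha, hb⟩ := exists_two_adj hw
      by_cases h : a = p
      · exact ⟨b, by grind, hb⟩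
      · exact ⟨a, h, ha⟩
    have hqp' := hs q p hqp huq hwp
    have hps' := hs p s hsp.symm hup hws
    by_cases hqs : q = s
    · subst hqs
      exact HasK4e.good ⟨p, q, u, w, hne, hqp'.symm, hup.symm, hwp.symm, huq.symm, hws.symm⟩
    · have hqs' := hs q s hqs huq hws
      refine HasK4e.good ⟨p, q, u, s, ?_, hqp'.symm, hup.symm, hps', huq.symm, hqs'⟩
      rintro rfl
      exact huw hws.symm
  · push Not at hc
    obtain ⟨p, q, hpq, hp, hq⟩ := exists_two_adj hu
    obtain ⟨r, s, hrs, hr, hs'⟩ := exists_two_adj hw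
    have hd : ∀ x y, G.Adj u x → G.Adj w y → G.Adj x y := fun x y hx hy =>
      hs x y (by rintro rfl; exact hc x hx hy) hx hy
    exact good_of_complete_between hpq hrs huw hne hp hq hr hs' (hd p r hp hr) (hd p s hp hs')
      (hd q r hq hr) (hd q s hq hs') (fun h => hc r h hr)

lemma deg_deleteIncidenceSet (G : SimpleGraph V) (u x : V) :
    deg G x = deg (G.deleteIncidenceSet u) x + (if G.Adj u x then 1 else 0) +
      (if x = u then deg G u else 0) := by
  unfold deg
  have h1 : (G.deleteIncidenceSet u).neighborSet x = {y | G.Adj x y ∧ x ≠ u ∧ y ≠ u} := by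
    ext y
    exact deleteIncidenceSet_adj
  rw [h1]
  by_cases hx : x = u
  · subst hx
    simp
  · by_cases ha : G.Adj u x
    · have : G.neighborSet x = insert u {y | G.Adj x y ∧ x ≠ u ∧ y ≠ u} := by
        ext y
        have := ha.symm
        simp only [mem_neighborSet, Set.mem_insert_iff, Set.mem_ofPred_eq]
        grind
      rw [this, Set.ncard_insert_of_notMem (by simp) (Set.toFinite _)]
      simp [ha, hx]
    · have : G.neighborSet x = {y | G.Adj x y ∧ x ≠ u ∧ y ≠ u} := by
        ext y
        have := @SimpleGraph.Adj.symm _ G x u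
        simp only [mem_neighborSet, Set.mem_ofPred_eq]
        grind
      rw [this]
      simp [ha, hx]

lemma deg_deleteIncidenceSet_self (G : SimpleGraph V) (u : V) :
    deg (G.deleteIncidenceSet u) u = 0 := by
  have := deg_deleteIncidenceSet G u u
  simp at this
  omega

lemma deg_deleteIncidenceSet_le (G : SimpleGraph V) (u x : V) :
    deg (G.deleteIncidenceSet u) x ≤ deg G x := by
  have := deg_deleteIncidenceSet G u x
  omega

lemma sum_deg_deleteIncidenceSet (G : SimpleGraph V) (u : V) :
    ∑ x, deg G x = ∑ x, deg (G.deleteIncidenceSet u) x + 2 * deg G u := by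
  rw [Finset.sum_congr rfl fun x _ => deg_deleteIncidenceSet G u x]
  simp only [Finset.sum_add_distrib, Finset.sum_ite_eq', Finset.mem_univ, if_true]
  have : ∑ x, (if G.Adj u x then 1 else 0) = deg G u := by
    have : G.neighborSet u = (Finset.univ.filter fun x => G.Adj u x : Finset V) := by
      ext
      simp
    rw [deg, this, Set.ncard_coe_finset, Finset.sum_boole, Nat.cast_id]
  omega

lemma Good.of_deleteIncidenceSet {G : SimpleGraph V} {u : V}
    (h : Good (G.deleteIncidenceSet u)) : Good G := by
  obtain ⟨H, hH, hK⟩ := h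
  have hu : ∀ y, ¬ H.Adj u y :=
    not_adj_of_deg_eq_zero (by rw [hH, deg_deleteIncidenceSet_self])
  refine ⟨H ⊔ (G \ G.deleteIncidenceSet u), fun x => ?_, hK.mono le_sup_left⟩
  have h1 : deg (G.deleteIncidenceSet u ⊔ (G \ G.deleteIncidenceSet u)) x = deg G x := by
    rw [sup_sdiff_cancel_right (G.deleteIncidenceSet_le u)]
  rw [deg_sup (by intro x y; simp only [sdiff_adj]; tauto)] at h1
  rw [deg_sup, hH, h1]
  intro x y hxy hxy'
  rw [sdiff_adj, deleteIncidenceSet_adj] at hxy'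
  have := hu x
  have := hu y
  have := hxy.symm
  grind

/-- Two isolated vertices can be turned into adjacent vertices of degree three by subdividing two
edges outside a copy of `K₄ - e`. -/
lemma exists_insert_two_cubic {G : SimpleGraph V} (hG : HasK4e G) (hsum : 14 ≤ ∑ x, deg G x)
    {u v : V} (huv : u ≠ v) (hu : deg G u = 0) (hv : deg G v = 0) :
    ∃ H : SimpleGraph V, HasK4e H ∧
      ∀ x, deg H x = deg G x + 3 * ind u x + 3 * ind v x := by
  obtain ⟨a, b, c, d, hcd, h1, h2, h3, h4, h5⟩ := hG
  have n1 := h1.ne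
  have n2 := h2.ne
  have n3 := h3.ne
  have n4 := h4.ne
  have n5 := h5.ne
  obtain ⟨G₁, d₁, a₁⟩ := exists_remove h1
  obtain ⟨G₂, d₂, a₂⟩ := exists_remove (G := G₁) (p := a) (q := c) (by rw [a₁]; grind)
  obtain ⟨G₃, d₃, a₃⟩ := exists_remove (G := G₂) (p := a) (q := d) (by
    simp only [a₂, a₁]; grind)
  obtain ⟨G₄, d₄, a₄⟩ := exists_remove (G := G₃) (p := b) (q := c) (by
    simp only [a₃, a₂, a₁]; grind)
  obtain ⟨G₅, d₅, a₅⟩ := exists_remove (G := G₄) (p := b) (q := d) (by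
    simp only [a₄, a₃, a₂, a₁]; grind)
  have s₁ := sum_deg_remove d₁
  have s₂ := sum_deg_remove d₂
  have s₃ := sum_deg_remove d₃
  have s₄ := sum_deg_remove d₄
  have s₅ := sum_deg_remove d₅
  obtain ⟨p, q, hpq⟩ := exists_adj_of_sum_deg_pos (G := G₅) (by omega)
  obtain ⟨G₆, d₆, a₆⟩ := exists_remove hpq
  have s₆ := sum_deg_remove d₆
  obtain ⟨r, s, hrs⟩ := exists_adj_of_sum_deg_pos (G := G₆) (by omega)
  simp only [a₆, a₅, a₄, a₃, a₂, a₁] at hpq hrs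
  clear d₁ d₂ d₃ d₄ d₅ d₆ a₁ a₂ a₃ a₄ a₅ a₆ s₁ s₂ s₃ s₄ s₅ s₆ G₁ G₂ G₃ G₄ G₅ G₆
  have hu' := not_adj_of_deg_eq_zero hu
  have hv' := not_adj_of_deg_eq_zero hv
  have gpq : G.Adj p q := by tauto
  have grs : G.Adj r s := by tauto
  have nu : ∀ x y, G.Adj x y → x ≠ u ∧ y ≠ u ∧ x ≠ v ∧ y ≠ v := by
    intro x y hxy
    refine ⟨?_, ?_, ?_, ?_⟩ <;> rintro rfl
    exacts [hu' _ hxy, hu' _ hxy.symm, hv' _ hxy, hv' _ hxy.symm]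
  obtain ⟨pu, qu, pv, qv⟩ := nu _ _ gpq
  obtain ⟨ru, su, rv, sv⟩ := nu _ _ grs
  have pq := gpq.ne
  have rs := grs.ne
  obtain ⟨G₁, d₁, a₁⟩ := exists_remove gpq
  obtain ⟨G₂, d₂, a₂⟩ := exists_remove (G := G₁) (p := r) (q := s) (by rw [a₁]; tauto)
  have Ku : ∀ x, ¬ G₂.Adj u x := by
    intro x; rw [a₂, a₁]; have := hu' x; tauto
  have Kv : ∀ x, ¬ G₂.Adj v x := by
    intro x; rw [a₂, a₁]; have := hv' x; tauto
  obtain ⟨G₃, d₃, a₃⟩ := exists_add huv (Ku v)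
  obtain ⟨G₄, d₄, a₄⟩ := exists_add (G := G₃) pu.symm (by rw [a₃]; grind)
  obtain ⟨G₅, d₅, a₅⟩ := exists_add (G := G₄) qu.symm (by rw [a₄, a₃]; grind)
  obtain ⟨G₆, d₆, a₆⟩ := exists_add (G := G₅) rv.symm (by rw [a₅, a₄, a₃]; grind)
  obtain ⟨G₇, d₇, a₇⟩ := exists_add (G := G₆) sv.symm (by rw [a₆, a₅, a₄, a₃]; grind)
  refine ⟨G₇, ?_, fun x => ?_⟩
  · have le : G₂ ≤ G₇ := by
      intro x y h
      rw [a₇, a₆, a₅, a₄, a₃]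
      exact Or.inl (Or.inl (Or.inl (Or.inl (Or.inl h))))
    refine HasK4e.mono le ⟨a, b, c, d, hcd, ?_, ?_, ?_, ?_, ?_⟩ <;> rw [a₂, a₁] <;> grind
  · linarith [d₁ x, d₂ x, d₃ x, d₄ x, d₅ x, d₆ x, d₇ x]

/-- A vertex `a` completing the triangle `u a b` and joined to both further neighbours of `v`. -/
lemma good_of_star {G : SimpleGraph V} {u v a b c d : V} (huv : G.Adj u v) (hua : G.Adj u a)
    (hub : G.Adj u b) (hvc : G.Adj v c) (hvd : G.Adj v d) (hav : a ≠ v) (hbv : b ≠ v)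
    (hcu : c ≠ u) (hdu : d ≠ u) (hbd : b ≠ d) (hcd : c ≠ d)
    (gab : G.Adj a b) (gac : G.Adj a c) (gad : G.Adj a d) : Good G := by
  by_cases ncd : G.Adj c d
  · exact HasK4e.good ⟨c, d, a, v, hav, ncd, gac.symm, hvc.symm, gad.symm, hvd.symm⟩
  by_cases nav : G.Adj a v
  · exact HasK4e.good ⟨a, v, c, d, hcd, nav, gac, gad, hvc, hvd⟩
  obtain ⟨H, hH, hadj⟩ := exists_switch hav hcd.symm gad hvc nav (fun h => ncd h.symm)
  have h1 := hua.symm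
  have h2 := hua.ne
  have h3 := huv.ne
  refine ⟨H, hH, a, u, b, v, hbv, ?_, ?_, ?_, ?_, ?_⟩ <;> rw [hadj] <;> grind

/-- Two adjacent vertices of degree three can be suppressed unless `K₄ - e` is at hand. -/
lemma good_or_exists_suppress {G : SimpleGraph V} {u v : V} (huv : G.Adj u v) (hu : deg G u = 3)
    (hv : deg G v = 3) :
    Good G ∨ ∃ H : SimpleGraph V,
      ∀ x, deg G x = deg H x + 3 * ind u x + 3 * ind v x := by
  by_cases hgood : Good G
  · exact Or.inl hgood
  refine Or.inr ?_
  have hK : ¬ HasK4e G := fun h => hgood h.good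
  obtain ⟨a, b, hab, hav, hbv, hua, hub⟩ := exists_two_adj_ne hu.ge huv
  obtain ⟨c, d, hcd, hcu, hdu, hvc, hvd⟩ := exists_two_adj_ne hv.ge huv.symm
  have noK : ∀ a b c d, c ≠ d → G.Adj a b → G.Adj a c → G.Adj a d → G.Adj b c → ¬ G.Adj b d :=
    fun a b c d h0 h1 h2 h3 h4 h5 => hK ⟨a, b, c, d, h0, h1, h2, h3, h4, h5⟩
  have uv := huv.ne
  have ua := hua.ne
  have ub := hub.ne
  have vc := hvc.ne
  have vd := hvd.ne
  obtain ⟨G₁, d₁, a₁⟩ := exists_remove huv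
  obtain ⟨G₂, d₂, a₂⟩ := exists_remove (G := G₁) (p := u) (q := a) (by rw [a₁]; grind)
  obtain ⟨G₃, d₃, a₃⟩ := exists_remove (G := G₂) (p := u) (q := b) (by
    simp only [a₂, a₁]; grind)
  obtain ⟨G₄, d₄, a₄⟩ := exists_remove (G := G₃) (p := v) (q := c) (by
    simp only [a₃, a₂, a₁]; grind)
  obtain ⟨G₅, d₅, a₅⟩ := exists_remove (G := G₄) (p := v) (q := d) (by
    simp only [a₄, a₃, a₂, a₁]; grind)
  have le : ∀ x y, G₅.Adj x y → G.Adj x y := by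
    intro x y
    rw [a₅, a₄, a₃, a₂, a₁]
    exact fun h => h.1.1.1.1.1
  have main : ∀ p q r s, p ≠ q → r ≠ s → ¬ G.Adj p q → ¬ G.Adj r s →
      ¬((r = p ∧ s = q) ∨ (r = q ∧ s = p)) →
      (∀ x, (ind p x + ind q x : ℕ) +
        (ind r x + ind s x) =
        ind a x + ind b x +
        (ind c x + ind d x)) →
      ∃ H : SimpleGraph V,
        ∀ x, deg G x = deg H x + 3 * ind u x + 3 * ind v x := by
    intro p q r s pq rs npq nrs hne hx
    obtain ⟨G₆, d₆, a₆⟩ := exists_add (G := G₅) pq (fun h => npq (le _ _ h))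
    obtain ⟨G₇, d₇, a₇⟩ := exists_add (G := G₆) rs (by
      rw [a₆]
      have := le r s
      tauto)
    refine ⟨G₇, fun x => ?_⟩
    have hx' := hx x
    linarith [d₁ x, d₂ x, d₃ x, d₄ x, d₅ x, d₆ x, d₇ x]

  -- a common neighbour of `u` and `v`
  have shared : ∀ a b c d, a ≠ b → c ≠ d → a = c → G.Adj u a → G.Adj u b → G.Adj v c →
      G.Adj v d → b ≠ v → d ≠ u → b ≠ d ∧ ¬ G.Adj a b ∧ ¬ G.Adj c d := by
    rintro a b c d hab hcd rfl hua hub hva hvd hbv hdu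
    refine ⟨?_, fun h => ?_, fun h => ?_⟩
    · rintro rfl
      exact noK u v a b hab huv hua hub hva hvd
    · exact noK u a v b hbv.symm hua huv hub hva.symm h
    · exact noK v a u d hdu.symm hva huv.symm hvd hua.symm h
  by_cases hac : a = c
  · obtain ⟨h1, h2, h3⟩ := shared a b c d hab hcd hac hua hub hvc hvd hbv hdu
    exact main a b c d hab hcd h2 h3 (by grind) (fun x => by ring)
  by_cases had : a = d
  · obtain ⟨h1, h2, h3⟩ := shared a b d c hab hcd.symm had hua hub hvd hvc hbv hcu
    exact main a b d c hab hcd.symm h2 h3 (by grind) (fun x => by ring)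
  by_cases hbc : b = c
  · obtain ⟨h1, h2, h3⟩ := shared b a c d hab.symm hcd hbc hub hua hvc hvd hav hdu
    exact main b a c d hab.symm hcd h2 h3 (by grind) (fun x => by ring)
  by_cases hbd : b = d
  · obtain ⟨h1, h2, h3⟩ := shared b a d c hab.symm hcd.symm hbd hub hua hvd hvc hav hcu
    exact main b a d c hab.symm hcd.symm h2 h3 (by grind) (fun x => by ring)
  by_cases c1 : ¬ G.Adj a b ∧ ¬ G.Adj c d
  · exact main a b c d hab hcd c1.1 c1.2 (by grind) (fun x => by ring)
  by_cases c2 : ¬ G.Adj a c ∧ ¬ G.Adj b d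
  · exact main a c b d hac hbd c2.1 c2.2 (by grind) (fun x => by ring)
  by_cases c3 : ¬ G.Adj a d ∧ ¬ G.Adj b c
  · exact main a d b c had hbc c3.1 c3.2 (by grind) (fun x => by ring)
  exfalso
  have star := fun u v a b c d h1 h2 h3 h4 h5 h6 h7 h8 h9 h10 h11 h12 h13 h14 =>
    hgood (good_of_star (G := G) (u := u) (v := v) (a := a) (b := b) (c := c) (d := d)
      h1 h2 h3 h4 h5 h6 h7 h8 h9 h10 h11 h12 h13 h14)
  have c1 : G.Adj a b ∨ G.Adj c d := by rwa [not_and_or, not_not, not_not] at c1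
  have c2 : G.Adj a c ∨ G.Adj b d := by rwa [not_and_or, not_not, not_not] at c2
  have c3 : G.Adj a d ∨ G.Adj b c := by rwa [not_and_or, not_not, not_not] at c3
  rcases c1 with c1 | c1 <;> rcases c2 with c2 | c2 <;> rcases c3 with c3 | c3
  · exact star u v a b c d huv hua hub hvc hvd hav hbv hcu hdu hbd hcd c1 c2 c3
  · exact noK a b c u hcu c1 c2 hua.symm c3 hub.symm
  · exact noK a b d u hdu c1 c3 hua.symm c2 hub.symm
  · exact star u v b a c d huv hub hua hvc hvd hbv hav hcu hdu had hcd c1.symm c3 c2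
  · exact noK c d a v hav c1 c2.symm hvc.symm c3.symm hvd.symm
  · exact star v u c d a b huv.symm hvc hvd hua hub hcu hdu hav hbv (Ne.symm hbd) hab
      c1 c2.symm c3.symm
  · exact star v u d c a b huv.symm hvd hvc hua hub hdu hcu hav hbv (Ne.symm hbc) hab
      c1.symm c3.symm c2.symm
  · exact noK c d b v hbv c1 c3.symm hvc.symm c2.symm hvd.symm

/-- Degrees are bounded by the size of a set containing the support. -/
lemma deg_lt_card {G : SimpleGraph V} {A : Finset V} (hA : ∀ x, x ∉ A → deg G x = 0) {x : V}
    (hx : x ∈ A) : deg G x < A.card := by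
  have : G.neighborSet x ⊆ (A.erase x : Finset V) := by
    intro y (hy : G.Adj x y)
    by_contra h
    have hyA : y ∉ A := by
      have := hy.ne
      simp at h
      tauto
    exact not_adj_of_deg_eq_zero (hA y hyA) x hy.symm
  have h2 := Set.ncard_le_ncard this (Set.toFinite _)
  rw [Set.ncard_coe_finset] at h2
  have := Finset.card_erase_lt_of_mem hx
  unfold deg
  omega

lemma adj_of_card_le_deg {G : SimpleGraph V} {A : Finset V} (hA : ∀ x, x ∉ A → deg G x = 0)
    {x y : V} (hx : x ∈ A) (hy : y ∈ A) (hxy : x ≠ y) (hd : A.card ≤ deg G x + 1) :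
    G.Adj x y := by
  by_contra hn
  have : G.neighborSet x ⊆ ((A.erase x).erase y : Finset V) := by
    intro z (hz : G.Adj x z)
    by_contra h
    have hzA : z ∉ A := by
      have := hz.ne
      have : z ≠ y := by rintro rfl; exact hn hz
      simp at h
      tauto
    exact not_adj_of_deg_eq_zero (hA z hzA) x hz.symm
  have h2 := Set.ncard_le_ncard this (Set.toFinite _)
  rw [Set.ncard_coe_finset, Finset.card_erase_of_mem (by simp [hy, hxy.symm]),
    Finset.card_erase_of_mem hx] at h2
  have : 1 < A.card := Finset.one_lt_card.2 ⟨x, hx, y, hy, hxy⟩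
  unfold deg at hd
  omega

lemma sum_deg_eq {G : SimpleGraph V} {A : Finset V} (hA : ∀ x, x ∉ A → deg G x = 0) :
    ∑ x ∈ A, deg G x = ∑ x, deg G x :=
  Finset.sum_subset (Finset.subset_univ A) fun x _ hx => hA x hx

/-- Deleting two vertices, in terms of the degrees. -/
lemma good_of_delete_two {G : SimpleGraph V} {u w : V}
    (h : Good ((G.deleteIncidenceSet u).deleteIncidenceSet w)) : Good G :=
  h.of_deleteIncidenceSet.of_deleteIncidenceSet

lemma sum_deg_delete_two {G : SimpleGraph V} {u w : V} (hne : u ≠ w) :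
    ∑ x, deg G x + 2 * (if G.Adj u w then 1 else 0) =
      ∑ x, deg ((G.deleteIncidenceSet u).deleteIncidenceSet w) x +
        2 * deg G u + 2 * deg G w := by
  have h1 := sum_deg_deleteIncidenceSet G u
  have h2 := sum_deg_deleteIncidenceSet (G.deleteIncidenceSet u) w
  have h3 := deg_deleteIncidenceSet G u w
  rw [if_neg hne.symm] at h3
  omega

lemma deg_delete_two_eq_zero {G : SimpleGraph V} {A : Finset V}
    (hA : ∀ x, x ∉ A → deg G x = 0) (u w x : V) (hx : x ∉ (A.erase u).erase w) :
    deg ((G.deleteIncidenceSet u).deleteIncidenceSet w) x = 0 := by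
  by_cases hw : x = w
  · rw [hw, deg_deleteIncidenceSet_self]
  have h1 := deg_deleteIncidenceSet_le (G.deleteIncidenceSet u) w x
  by_cases hu : x = u
  · rw [hu] at h1 ⊢
    rw [deg_deleteIncidenceSet_self] at h1
    omega
  have h2 := deg_deleteIncidenceSet_le G u x
  have h3 := hA x (by simp at hx; tauto)
  omega

/-- The main result for graphs whose edges lie within a set of `2 * k + 3` vertices. -/
theorem good_of_sum_deg (k : ℕ) : ∀ (A : Finset V) (G : SimpleGraph V), A.card = 2 * k + 3 →
    (∀ x, x ∉ A → deg G x = 0) → 3 * A.card ≤ ∑ x, deg G x + 1 → Good G := by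
  induction k with
  | zero =>
    intro A G hcard hA hsum
    have h1 : ∑ x ∈ A, deg G x ≤ ∑ x ∈ A, 2 :=
      Finset.sum_le_sum fun x hx => by have := deg_lt_card hA hx; omega
    rw [sum_deg_eq hA, Finset.sum_const, smul_eq_mul] at h1
    omega
  | succ k ih =>
    intro A G hcard hA hsum
    have card2 : ∀ u ∈ A, ∀ w ∈ A, u ≠ w → ((A.erase u).erase w).card = 2 * k + 3 := by
      intro u hu w hw hne
      rw [Finset.card_erase_of_mem (by simp [hw, hne.symm]), Finset.card_erase_of_mem hu]
      omega
    have delete : ∀ H : SimpleGraph V, (∀ x, deg H x = deg G x) → ∀ u ∈ A, ∀ w ∈ A, u ≠ w →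
        6 * k + 8 + 2 * deg G u + 2 * deg G w ≤
          ∑ x, deg G x + 2 * (if H.Adj u w then 1 else 0) → Good G := by
      intro H hH u hu w hw hne hle
      refine Good.of_deg_eq hH (good_of_delete_two (u := u) (w := w)
        (ih ((A.erase u).erase w) _ (card2 u hu w hw hne)
          (deg_delete_two_eq_zero (fun x hx => by rw [hH, hA x hx]) u w) ?_))
      have := sum_deg_delete_two (G := H) hne
      simp only [hH] at this
      rw [card2 u hu w hw hne]
      omega
    have delete_adj : ∀ u ∈ A, ∀ w ∈ A, u ≠ w → 2 ≤ deg G u → 2 ≤ deg G w →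
        6 * k + 8 + 2 * deg G u + 2 * deg G w ≤ ∑ x, deg G x + 2 → Good G := by
      intro u hu w hw hne h2u h2w hle
      obtain h | ⟨H, hH, hadj⟩ := good_or_exists_adj hne h2u h2w
      · exact h
      · exact delete H hH u hu w hw hne (by rw [if_pos hadj]; omega)
    by_cases low : ∃ u ∈ A, ∃ w ∈ A, u ≠ w ∧ deg G u ≤ 2 ∧ deg G w ≤ 2
    · obtain ⟨u, hu, w, hw, hne, h2u, h2w⟩ := low
      by_cases h : deg G u = 2 ∧ deg G w = 2
      · exact delete_adj u hu w hw hne h.1.ge h.2.ge (by omega)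
      · exact delete G (fun _ => rfl) u hu w hw hne (by omega)
    by_cases cubic : ∃ u ∈ A, ∃ w ∈ A, u ≠ w ∧ deg G u = 3 ∧ deg G w = 3
    · obtain ⟨u, hu, w, hw, hne, h3u, h3w⟩ := cubic
      obtain h | ⟨H, hH, hadj⟩ :=
        good_or_exists_adj (G := G) hne (by omega) (by omega)
      · exact h
      obtain h | ⟨K, hK⟩ := good_or_exists_suppress hadj (by rw [hH, h3u]) (by rw [hH, h3w])
      · exact h.of_deg_eq hH
      have hKu : deg K u = 0 := by
        have := hK u
        simp [hH, h3u, hne, ind] at this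
        exact this
      have hKw : deg K w = 0 := by
        have := hK w
        simp [hH, h3w, hne.symm, ind] at this
        exact this
      have hKA : ∀ x, x ∉ (A.erase u).erase w → deg K x = 0 := by
        intro x hx
        by_cases hxw : x = w
        · rw [hxw, hKw]
        by_cases hxu : x = u
        · rw [hxu, hKu]
        have := hK x
        rw [hH, hA x (by simp at hx; tauto)] at this
        omega
      have hsumK : ∑ x, deg G x = ∑ x, deg K x + 6 := by
        rw [← Finset.sum_congr rfl fun x _ => hH x, Finset.sum_congr rfl fun x _ => hK x]
        simp [Finset.sum_add_distrib, ind]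
      have cK := card2 u hu w hw hne
      obtain ⟨L, hL, hLK⟩ := ih _ K cK hKA (by omega)
      have hsumL : ∑ x, deg L x = ∑ x, deg K x := Finset.sum_congr rfl fun x _ => hL x
      have h14 : 14 ≤ ∑ x, deg L x := by
        have hb : ∑ x ∈ (A.erase u).erase w, deg K x ≤ ∑ x ∈ (A.erase u).erase w, (2 * k + 2) :=
          Finset.sum_le_sum fun x hx => by have := deg_lt_card hKA hx; omega
        rw [sum_deg_eq hKA, Finset.sum_const, smul_eq_mul, cK] at hb
        rcases k with _ | k <;> omega
      obtain ⟨M, hM, hMd⟩ := exists_insert_two_cubic hLK h14 hne (by rw [hL, hKu])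
        (by rw [hL, hKw])
      exact ⟨M, fun x => by rw [hMd, hL, ← hH, hK], hM⟩
    push Not at low cubic
    obtain ⟨u, hu, humin⟩ := A.exists_min_image (deg G) (Finset.card_pos.1 (by omega))
    obtain ⟨w, hw, hwmin⟩ := (A.erase u).exists_min_image (deg G)
      (Finset.card_pos.1 (by rw [Finset.card_erase_of_mem hu]; omega))
    obtain ⟨hwu, hwA⟩ := Finset.mem_erase.1 hw
    have huw := humin w hwA
    have hw3 : 3 ≤ deg G w := by
      by_contra! h
      have := low u hu w hwA hwu.symm (by omega)
      omega
    have cB := card2 u hu w hwA hwu.symm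
    have rest : ∀ x ∈ (A.erase u).erase w, 4 ≤ deg G x ∧ deg G w ≤ deg G x := by
      intro x hx
      simp only [Finset.mem_erase] at hx
      have h1 := hwmin x (by simp [hx])
      have h2 := cubic w hwA x hx.2.2 (Ne.symm hx.1)
      exact ⟨by omega, h1⟩
    rcases Nat.eq_zero_or_pos k with rfl | hk
    · obtain ⟨x, y, z, hxy, hxz, hyz, hB⟩ := Finset.card_eq_three.1 cB
      have hx : x ∈ (A.erase u).erase w := by simp [hB]
      have hy : y ∈ (A.erase u).erase w := by simp [hB]
      have h4x := (rest x hx).1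
      have h4y := (rest y hy).1
      simp only [Finset.mem_erase] at hx hy
      have jx : ∀ t ∈ A, x ≠ t → G.Adj x t := fun t ht hxt =>
        adj_of_card_le_deg hA hx.2.2 ht hxt (by omega)
      have jy : ∀ t ∈ A, y ≠ t → G.Adj y t := fun t ht hyt =>
        adj_of_card_le_deg hA hy.2.2 ht hyt (by omega)
      exact HasK4e.good ⟨x, y, u, w, hwu.symm, jx y hy.2.2 hxy, jx u hu hx.2.1, jx w hwA hx.1,
        jy u hu hy.2.1, jy w hwA hy.1⟩
    obtain ⟨m, hm4, hmw, hm, hmle⟩ : ∃ m, 4 ≤ m ∧ deg G w ≤ m ∧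
        (∀ x ∈ (A.erase u).erase w, m ≤ deg G x) ∧ (m = 4 ∨ m = deg G w) :=
      ⟨max 4 (deg G w), by omega, by omega, fun x hx => by have := rest x hx; omega, by omega⟩
    have hS : (2 * k + 3) * m + deg G w + deg G u ≤ ∑ x, deg G x := by
      rw [← sum_deg_eq hA, ← Finset.sum_erase_add A _ hu, ← Finset.sum_erase_add (A.erase u) _ hw]
      have := Finset.sum_le_sum hm
      rw [Finset.sum_const, smul_eq_mul, cB] at this
      omega
    obtain ⟨j, rfl⟩ := Nat.exists_eq_add_of_lt hk
    obtain ⟨i, rfl⟩ := Nat.exists_eq_add_of_le hm4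
    have hS' : 8 * j + 20 + 5 * i + deg G w + deg G u ≤ ∑ x, deg G x := by nlinarith
    by_cases h2 : 2 ≤ deg G u
    · exact delete_adj u hu w hwA hwu.symm h2 (by omega) (by omega)
    · exact delete G (fun _ => rfl) u hu w hwA hwu.symm (by omega)

end K4eDegree

theorem stmt_0 (n : ℕ) (hodd : Odd n) (hn : n = 5 ∨ 7 ≤ n)
    (S : Fin n → ℕ) (hgr : Graphical S) (hsum : 3 * n - 1 ≤ ∑ i, S i) :
    ∃ G : SimpleGraph (Fin n), IsRealization S G ∧ ContainsSub G K4e := by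
  obtain ⟨G, hG⟩ := hgr
  have hdeg : ∀ (H : SimpleGraph (Fin n)) (x : Fin n), K4eDegree.deg H x = H.degree x := by
    intro H x
    rw [K4eDegree.deg, Set.ncard_eq_toFinset_card', ← SimpleGraph.card_neighborFinset_eq_degree]
    rfl
  have hsumG : ∑ x, K4eDegree.deg G x = ∑ i, S i := by
    simp only [hdeg]
    exact congrArg Multiset.sum hG
  obtain ⟨k, hk⟩ := hodd
  obtain ⟨H, hH, a, b, c, d, hcd, hab, hac, had, hbc, hbd⟩ :=
    K4eDegree.good_of_sum_deg (k - 1) Finset.univ G (by rw [Finset.card_fin]; omega) (by simp)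
      (by rw [Finset.card_fin, hsumG]; omega)
  refine ⟨H, ?_, ?_⟩
  · have : (fun v => H.degree v) = fun v => G.degree v := by
      funext v
      rw [← hdeg, ← hdeg, hH]
    unfold IsRealization at hG ⊢
    rw [← hG]
    exact congrArg (Multiset.map · Finset.univ.val) this
  · have hinj : Function.Injective ![c, d, a, b] := by
      have := hab.ne
      have := hac.ne
      have := had.ne
      have := hbc.ne
      have := hbd.ne
      intro i j
      fin_cases i <;> fin_cases j <;> simp <;> grind
    refine ⟨⟨![c, d, a, b], hinj⟩, fun i j hij => ?_⟩
    have := hab.symm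
    have := hac.symm
    have := had.symm
    have := hbc.symm
    have := hbd.symm
    fin_cases i <;> fin_cases j <;> simp [K4e] at hij ⊢ <;> assumption
end
end

section
/- For every even integer n with n = 4 or n ≥ 8, every graphical sequence S of n nonnegative integers with sum σ(S) ≥ 3n − 2 has a realization containing K₄−e as a subgraph (i.e., S is potentially K₄−e graphical). -/
open scoped Classical

noncomputable section

variable {V : Type*} [Fintype V]

/-- A 2-switch: replacing the edges `ab`, `cd` by the non-edges `ac`, `bd` keeps all degrees. -/
theorem exists_switch (G : SimpleGraph V) {a b c d : V} (hab : G.Adj a b) (hcd : G.Adj c d)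
    (hac : ¬ G.Adj a c) (hbd : ¬ G.Adj b d) (nac : a ≠ c) (nbd : b ≠ d) :
    ∃ G' : SimpleGraph V, (∀ t, G'.degree t = G.degree t) ∧ ∀ p q, G'.Adj p q ↔
      (G.Adj p q ∧ ¬ ((p = a ∧ q = b) ∨ (p = b ∧ q = a) ∨ (p = c ∧ q = d) ∨ (p = d ∧ q = c))) ∨
        (p = a ∧ q = c) ∨ (p = c ∧ q = a) ∨ (p = b ∧ q = d) ∨ (p = d ∧ q = b) := by
  have hsymm : ∀ p q, G.Adj p q → G.Adj q p := fun p q h => h.symm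
  have hirr : ∀ p, ¬ G.Adj p p := fun p => G.loopless.irrefl p
  refine ⟨⟨fun p q =>
      (G.Adj p q ∧ ¬ ((p = a ∧ q = b) ∨ (p = b ∧ q = a) ∨ (p = c ∧ q = d) ∨ (p = d ∧ q = c))) ∨
        (p = a ∧ q = c) ∨ (p = c ∧ q = a) ∨ (p = b ∧ q = d) ∨ (p = d ∧ q = b),
      ⟨by grind⟩, ⟨by grind⟩⟩, ?_, fun p q => Iff.rfl⟩
  intro t
  have key : ∀ (G₁ : SimpleGraph V) (t x y : V), G.Adj t x → ¬ G.Adj t y →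
      (∀ q, G₁.Adj t q ↔ (G.Adj t q ∧ q ≠ x) ∨ q = y) → G₁.degree t = G.degree t := by
    intro G₁ t x y hx hy h
    have : G₁.neighborFinset t = insert y ((G.neighborFinset t).erase x) := by
      ext q
      simp only [SimpleGraph.mem_neighborFinset, Finset.mem_insert, Finset.mem_erase, h]
      tauto
    rw [← SimpleGraph.card_neighborFinset_eq_degree, this, Finset.card_insert_of_notMem,
      Finset.card_erase_add_one, SimpleGraph.card_neighborFinset_eq_degree]
    · simpa using hx
    · simp [hy]
  by_cases ta : t = a
  · exact key _ t b c (by grind) (by grind) (by intro q; simp only; grind)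
  by_cases tb : t = b
  · exact key _ t a d (by grind) (by grind) (by intro q; simp only; grind)
  by_cases tc : t = c
  · exact key _ t d a (by grind) (by grind) (by intro q; simp only; grind)
  by_cases td : t = d
  · exact key _ t c b (by grind) (by grind) (by intro q; simp only; grind)
  rw [← SimpleGraph.card_neighborFinset_eq_degree, ← SimpleGraph.card_neighborFinset_eq_degree]
  congr 1
  ext q
  simp only [SimpleGraph.mem_neighborFinset]
  grind

/-- Every edge of `G` lies in at most one triangle, i.e. `G` has no subgraph `K₄ - e`. -/
def K4eFree (G : SimpleGraph V) : Prop :=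
  ∀ p q r s, G.Adj p q → G.Adj p r → G.Adj q r → G.Adj p s → G.Adj q s → r = s

/-- `uv` is an edge of the `K₄ - e`-free graph `G`, and no graph with the same degrees and with
the edge `uv` has a strictly larger set of common neighbors of `u` and `v`. -/
structure Extremal (G : SimpleGraph V) (u v : V) : Prop where
  adj : G.Adj u v
  free : K4eFree G
  max : ∀ G' : SimpleGraph V, (∀ t, G'.degree t = G.degree t) → G'.Adj u v →
    (∀ w, G.Adj u w → G.Adj v w → G'.Adj u w ∧ G'.Adj v w) →
    ∀ a, G'.Adj u a → G'.Adj v a → G.Adj u a ∧ G.Adj v a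

/-- `x` is a neighbor of `u` outside the closed neighborhood of `v`. -/
def IsPrivate (G : SimpleGraph V) (u v x : V) : Prop := G.Adj u x ∧ ¬ G.Adj v x ∧ x ≠ v

namespace Extremal

variable {G : SimpleGraph V} {u v x y : V}

theorem symm (h : Extremal G u v) : Extremal G v u where
  adj := h.adj.symm
  free := h.free
  max G' hd ha hc a h1 h2 :=
    (h.max G' hd ha.symm (fun w hu hv => (hc w hv hu).symm) a h2 h1).symm

theorem adj_of_adj_private (h : Extremal G u v) (hx : IsPrivate G u v x) (hy : IsPrivate G v u y)
    {b : V} (hb : G.Adj y b) (hbv : b ≠ v) (hbx : b ≠ x) : G.Adj x b := by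
  by_contra hxb
  obtain ⟨hx1, hx2, hx3⟩ := hx
  obtain ⟨hy1, hy2, hy3⟩ := hy
  have hsymm : ∀ p q, G.Adj p q → G.Adj q p := fun p q h => h.symm
  have huv := h.adj
  obtain ⟨G', hd, hG⟩ := exists_switch G hx1 hb hy2 hxb hy3.symm hbx.symm
  exact hy2 (h.max G' hd (by grind) (by grind) y (by grind) (by grind)).1

theorem false_of_two_neighbors (h : Extremal G u v) (hx : IsPrivate G u v x)
    (hy : IsPrivate G v u y) {a r s : V} (hau : a ≠ u) (hav : a ≠ v) (hua : ¬ G.Adj u a)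
    (hva : ¬ G.Adj v a) (hr : G.Adj a r) (hs : G.Adj a s) (hrs : r ≠ s) (hrx : r ≠ x)
    (hxr : ¬ G.Adj x r) (hsy : s ≠ y) (hys : ¬ G.Adj y s) (hne : ¬ (r = y ∧ s = x)) : False := by
  obtain ⟨hx1, hx2, hx3⟩ := hx
  obtain ⟨hy1, hy2, hy3⟩ := hy
  have hsymm : ∀ p q, G.Adj p q → G.Adj q p := fun p q h => h.symm
  have huv := h.adj
  obtain ⟨G', hd, hG⟩ := exists_switch G hx1 hr hua hxr hau.symm hrx.symm
  obtain ⟨G'', hd', hG'⟩ := exists_switch G' (a := v) (b := y) (c := a) (d := s)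
    (by grind) (by grind) (by grind) (by grind) hav.symm hsy.symm
  refine hua (h.max G'' (fun t => (hd' t).trans (hd t)) ?_ ?_ a ?_ ?_).1
  · rw [hG', hG]; grind
  · intro w hw1 hw2
    rw [hG', hG', hG, hG]; grind
  · rw [hG', hG]; grind
  · rw [hG', hG]; grind

theorem private_indep (h : Extremal G u v) (hx : IsPrivate G u v x) (hy : IsPrivate G v u y)
    {x' : V} (hx' : IsPrivate G u v x') : ¬ G.Adj x x' := by
  intro hxx
  have hyx' : G.Adj y x' := h.symm.adj_of_adj_private hy hx hxx hx'.1.ne' (by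
    rintro rfl; exact hx'.2.1 hy.1)
  have hyx : G.Adj y x := h.symm.adj_of_adj_private hy hx' hxx.symm hx.1.ne' (by
    rintro rfl; exact hx.2.1 hy.1)
  exact hy.2.2 (h.free x x' u y hxx hx.1.symm hx'.1.symm hyx.symm hyx'.symm).symm

theorem private_unique_of_adj (h : Extremal G u v) (hx : IsPrivate G u v x)
    (hy : IsPrivate G v u y) (hxy : G.Adj x y) {x' : V} (hx' : IsPrivate G u v x') : x' = x := by
  by_contra hne
  exact h.private_indep hx' hy hx
    (h.adj_of_adj_private hx' hy hxy.symm hx.2.2 (Ne.symm hne))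

/-- A vertex away from `u`, `v` has at most one neighbor not adjacent to `x`. -/
theorem eq_of_not_adj (h : Extremal G u v) (hx : IsPrivate G u v x)
    (hy : IsPrivate G v u y) {a r s : V} (hau : a ≠ u) (hav : a ≠ v) (hua : ¬ G.Adj u a)
    (hva : ¬ G.Adj v a) (hxa : ¬ G.Adj x a) (hr : G.Adj a r) (hs : G.Adj a s)
    (hxr : ¬ G.Adj x r) (hxs : ¬ G.Adj x s) : r = s := by
  by_contra hrs
  have hax : a ≠ x := by rintro rfl; exact hua hx.1
  have hay : a ≠ y := by rintro rfl; exact hva hy.1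
  have hya : ¬ G.Adj y a := fun e => hxa (h.adj_of_adj_private hx hy e hav hax)
  have hys : ¬ G.Adj y s := fun e => hxs (h.adj_of_adj_private hx hy e
    (by rintro rfl; exact hva hs.symm) (by rintro rfl; exact hxa hs.symm))
  exact h.false_of_two_neighbors hx hy hau hav hua hva hr hs hrs
    (by rintro rfl; exact hxa hr.symm) hxr (by rintro rfl; exact hya hs.symm) hys
    (by rintro ⟨rfl, -⟩; exact hya hr.symm)

/-- If `x` and `y` are not adjacent, the common neighbors of `x` and `y` have degree two. -/
theorem eq_or_eq_of_adj (h : Extremal G u v) (hx : IsPrivate G u v x)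
    (hy : IsPrivate G v u y) (hxy : ¬ G.Adj x y) {z s : V} (hxz : G.Adj x z) (hyz : G.Adj y z)
    (hs : G.Adj z s) : s = x ∨ s = y := by
  by_contra! hne
  have hxny : x ≠ y := by rintro rfl; exact hx.2.1 hy.1
  have huz : ¬ G.Adj u z := fun e => by
    by_cases hvz : G.Adj v z
    · exact hx.2.2 (h.free u z v x e h.adj hvz.symm hx.1 hxz.symm).symm
    · exact h.private_indep hx hy ⟨e, hvz, by rintro rfl; exact hx.2.1 hxz.symm⟩ hxz
  have hvz : ¬ G.Adj v z := fun e =>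
    h.symm.private_indep hy hx ⟨e, huz, by rintro rfl; exact hy.2.1 hyz.symm⟩ hyz
  have hys : ¬ G.Adj y s := fun e => by
    have := h.adj_of_adj_private hx hy e (by rintro rfl; exact hvz hs.symm) hne.1
    exact hxny (h.free z s x y hs hxz.symm this.symm hyz.symm e.symm)
  exact h.false_of_two_neighbors hx hy (by rintro rfl; exact hy.2.1 hyz.symm)
    (by rintro rfl; exact hx.2.1 hxz.symm) huz hvz hyz.symm hs hne.2.symm hxny.symm hxy
    hne.2 hys (fun e => hne.1 e.2)

end Extremal

/-- If all degrees outside a set of three vertices are at most one, the degree sum is small. -/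
theorem sum_degree_le_of_degree_le_one (G : SimpleGraph V) (T : Finset V) (hT : T.card ≤ 3)
    (h : ∀ t ∉ T, G.degree t ≤ 1) : ∑ t, G.degree t ≤ 2 * Fintype.card V := by
  have hswap : ∑ a ∈ T, G.degree a = ∑ t, (T.filter (G.Adj t)).card := by
    have : ∀ a, G.degree a = ∑ t, if G.Adj t a then 1 else 0 := fun a => by
      rw [← SimpleGraph.card_neighborFinset_eq_degree, SimpleGraph.neighborFinset_eq_filter,
        Finset.card_filter]
      simp only [G.adj_comm]
    simp only [this, Finset.card_filter]
    exact Finset.sum_comm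
  have hsplit : ∑ t, G.degree t =
      ∑ t, ((T.filter (G.Adj t)).card + if t ∈ T then 0 else G.degree t) := by
    rw [Finset.sum_add_distrib, ← hswap, ← Finset.sum_filter_add_sum_filter_not _ (· ∈ T),
      Finset.filter_mem_eq_inter, Finset.univ_inter, Finset.sum_filter]
    simp only [ite_not]
  rw [hsplit, mul_comm, ← smul_eq_mul]
  refine Finset.sum_le_card_nsmul _ _ _ fun t _ => ?_
  split_ifs with ht
  · have : T.filter (G.Adj t) ⊆ T.erase t := fun s hs => by
      rw [Finset.mem_filter] at hs
      exact Finset.mem_erase.2 ⟨hs.2.ne', hs.1⟩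
    have := Finset.card_le_card this
    rw [Finset.card_erase_of_mem ht] at this
    omega
  · have : T.filter (G.Adj t) ⊆ G.neighborFinset t := fun s hs => by
      rw [Finset.mem_filter] at hs
      simpa using hs.2
    have := Finset.card_le_card this
    rw [SimpleGraph.card_neighborFinset_eq_degree] at this
    have := h t ht
    omega

theorem card_le_sum_degree (G : SimpleGraph V) (hd : ∀ t, G.degree t ≤ 3)
    (hsum : 3 * Fintype.card V ≤ ∑ t, G.degree t + 2) (T : Finset V) :
    3 * T.card ≤ ∑ t ∈ T, G.degree t + 2 := by
  have h1 := Finset.sum_add_sum_compl T fun t => G.degree t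
  have h2 : ∑ t ∈ Tᶜ, G.degree t ≤ Tᶜ.card • 3 := Finset.sum_le_card_nsmul _ _ _ fun t _ => hd t
  have h3 := T.card_add_card_compl
  rw [smul_eq_mul] at h2
  omega

namespace Extremal

variable {G : SimpleGraph V} {u v x y : V}

theorem exists_private (h : Extremal G u v) (hu : 3 ≤ G.degree u) : ∃ x, IsPrivate G u v x := by
  have hc : 1 < ((G.neighborFinset u).erase v).card := by
    rw [Finset.card_erase_of_mem (by simpa using h.adj), SimpleGraph.card_neighborFinset_eq_degree]
    omega
  obtain ⟨p, hp, q, hq, hpq⟩ := Finset.one_lt_card.1 hc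
  simp only [Finset.mem_erase, SimpleGraph.mem_neighborFinset] at hp hq
  by_contra! hno
  have hvp : G.Adj v p := by_contra fun e => hno p ⟨hp.2, e, hp.1⟩
  have hvq : G.Adj v q := by_contra fun e => hno q ⟨hq.2, e, hq.1⟩
  exact hpq (h.free u v p q h.adj hp.2 hvp hq.2 hvq)

theorem card_common_le_one (h : Extremal G u v) :
    (Finset.univ.filter fun w => G.Adj u w ∧ G.Adj v w).card ≤ 1 := by
  refine Finset.card_le_one.2 fun p hp q hq => ?_
  simp only [Finset.mem_filter, Finset.mem_univ, true_and] at hp hq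
  exact h.free u v p q h.adj hp.1 hp.2 hq.1 hq.2

theorem degree_le_three (h : Extremal G u v) (hux : ∀ x', IsPrivate G u v x' → x' = x) :
    G.degree u ≤ 3 := by
  have hsub : G.neighborFinset u ⊆
      insert v (insert x (Finset.univ.filter fun w => G.Adj u w ∧ G.Adj v w)) := fun t ht => by
    simp only [SimpleGraph.mem_neighborFinset] at ht
    simp only [Finset.mem_insert, Finset.mem_filter, Finset.mem_univ, true_and]
    by_cases htv : t = v
    · exact Or.inl htv
    by_cases hvt : G.Adj v t
    · exact Or.inr (Or.inr ⟨ht, hvt⟩)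
    · exact Or.inr (Or.inl (hux t ⟨ht, hvt, htv⟩))
  have h1 := Finset.card_le_card hsub
  rw [SimpleGraph.card_neighborFinset_eq_degree] at h1
  have h2 := Finset.card_insert_le v
    (insert x (Finset.univ.filter fun w => G.Adj u w ∧ G.Adj v w))
  have h3 := Finset.card_insert_le x (Finset.univ.filter fun w => G.Adj u w ∧ G.Adj v w)
  have h4 := h.card_common_le_one
  omega

theorem private_unique_of_common (h : Extremal G u v) (hx : IsPrivate G u v x)
    (hy : IsPrivate G v u y) (hxy : ¬ G.Adj x y) {z : V} (hxz : G.Adj x z) (hyz : G.Adj y z)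
    {x' : V} (hx' : IsPrivate G u v x') : x' = x := by
  have hzv : z ≠ v := by rintro rfl; exact hx.2.1 hxz.symm
  have hzx' : z ≠ x' := by rintro rfl; exact h.private_indep hx hy hx' hxz
  have := h.adj_of_adj_private hx' hy hyz hzv hzx'
  refine (h.eq_or_eq_of_adj hx hy hxy hxz hyz this.symm).resolve_right ?_
  rintro rfl
  exact hx'.2.1 hy.1

/-- The case in which all private neighbors of `u` and of `v` are leaves. -/
theorem sum_degree_le_of_leaves (h : Extremal G u v) (hx : IsPrivate G u v x)
    (hy : IsPrivate G v u y) (hX : ∀ x', IsPrivate G u v x' → ∀ b, G.Adj x' b → b = u)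
    (hY : ∀ y', IsPrivate G v u y' → ∀ b, G.Adj y' b → b = v) :
    ∑ t, G.degree t ≤ 2 * Fintype.card V := by
  refine sum_degree_le_of_degree_le_one G
    (insert u (insert v (Finset.univ.filter fun w => G.Adj u w ∧ G.Adj v w))) ?_ ?_
  · have h2 := Finset.card_insert_le u
      (insert v (Finset.univ.filter fun w => G.Adj u w ∧ G.Adj v w))
    have h3 := Finset.card_insert_le v (Finset.univ.filter fun w => G.Adj u w ∧ G.Adj v w)
    have h4 := h.card_common_le_one
    omega
  · intro t ht
    simp only [Finset.mem_insert, Finset.mem_filter, Finset.mem_univ, true_and, not_or,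
      not_and] at ht
    rw [← SimpleGraph.card_neighborFinset_eq_degree]
    refine Finset.card_le_one.2 fun r hr s hs => ?_
    simp only [SimpleGraph.mem_neighborFinset] at hr hs
    by_cases hut : G.Adj u t
    · have ht' : IsPrivate G u v t := ⟨hut, ht.2.2 hut, ht.2.1⟩
      rw [hX t ht' r hr, hX t ht' s hs]
    by_cases hvt : G.Adj v t
    · have ht' : IsPrivate G v u t := ⟨hvt, hut, ht.1⟩
      rw [hY t ht' r hr, hY t ht' s hs]
    · exact h.eq_of_not_adj hx hy ht.1 ht.2.1 hut hvt (fun e => ht.1 (hX x hx t e)) hr hs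
        (fun e => hut (hX x hx r e ▸ hr.symm)) (fun e => hut (hX x hx s e ▸ hs.symm))

/-- Away from `u`, `v`, `x`, `y`, a vertex has at most one neighbor that is not a common neighbor
of `x` and `y`. -/
theorem degree_le_of_notMem (h : Extremal G u v) (hx : IsPrivate G u v x)
    (hy : IsPrivate G v u y) (huy : ∀ y', IsPrivate G v u y' → y' = y) {a : V}
    (ha : a ∉ insert u (insert y (G.neighborFinset u ∪
      Finset.univ.filter fun z => G.Adj x z ∧ G.Adj y z))) :
    G.degree a ≤ 1 +
      (Finset.univ.filter fun z => G.Adj a z ∧ G.Adj x z ∧ G.Adj y z).card := by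
  simp only [Finset.mem_insert, Finset.mem_union, Finset.mem_filter, Finset.mem_univ, true_and,
    SimpleGraph.mem_neighborFinset, not_or, not_and] at ha
  obtain ⟨hau, hay, hua, hxya⟩ := ha
  have hav : a ≠ v := by rintro rfl; exact hua h.adj
  have hax : a ≠ x := by rintro rfl; exact hua hx.1
  have hva : ¬ G.Adj v a := fun e => hay (huy a ⟨e, hua, hau⟩)
  have hxa : ¬ G.Adj x a := fun e => hxya e (h.symm.adj_of_adj_private hy hx e hau hay)
  have hya : ¬ G.Adj y a := fun e => hxa (h.adj_of_adj_private hx hy e hav hax)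
  have hnot : ∀ r, G.Adj a r → ¬ (G.Adj x r ∧ G.Adj y r) → ¬ G.Adj x r := fun r hr hn e =>
    hn ⟨e, h.symm.adj_of_adj_private hy hx e (by rintro rfl; exact hua hr.symm)
      (by rintro rfl; exact hya hr.symm)⟩
  rw [← SimpleGraph.card_neighborFinset_eq_degree, SimpleGraph.neighborFinset_eq_filter,
    ← Finset.card_filter_add_card_filter_not (fun z => G.Adj x z ∧ G.Adj y z), add_comm,
    Finset.filter_filter, Finset.filter_filter]
  refine Nat.add_le_add_right (Finset.card_le_one.2 fun r hr s hs => ?_) _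
  simp only [Finset.mem_filter, Finset.mem_univ, true_and] at hr hs
  exact h.eq_of_not_adj hx hy hau hav hua hva hxa hr.1 hs.1 (hnot r hr.1 hr.2) (hnot s hs.1 hs.2)

theorem false_of_connected_privates (h : Extremal G u v) (hu : 3 ≤ G.degree u)
    (htop : ∀ t, t ≠ u → G.degree t ≤ G.degree v)
    (hcard : Fintype.card V = 4 ∨ 8 ≤ Fintype.card V)
    (hsum : 3 * Fintype.card V ≤ ∑ t, G.degree t + 2) (hx : IsPrivate G u v x)
    (hy : IsPrivate G v u y) (hxy : G.Adj x y ∨ ∃ z, G.Adj x z ∧ G.Adj y z) : False := by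
  have hux : ∀ x', IsPrivate G u v x' → x' = x := fun x' hx' => by
    by_cases e : G.Adj x y
    · exact h.private_unique_of_adj hx hy e hx'
    · obtain ⟨z, hz⟩ := hxy.resolve_left e
      exact h.private_unique_of_common hx hy e hz.1 hz.2 hx'
  have huy : ∀ y', IsPrivate G v u y' → y' = y := fun y' hy' => by
    by_cases e : G.Adj x y
    · exact h.symm.private_unique_of_adj hy hx e.symm hy'
    · obtain ⟨z, hz⟩ := hxy.resolve_left e
      exact h.symm.private_unique_of_common hy hx (fun f => e f.symm) hz.2 hz.1 hy'
  have hdu := h.degree_le_three hux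
  have hdv := h.symm.degree_le_three huy
  have hd : ∀ t, G.degree t ≤ 3 := fun t => by
    by_cases e : t = u
    · rwa [e]
    · exact (htop t e).trans hdv
  have hdef := card_le_sum_degree G hd hsum
  have hyu : y ∉ G.neighborFinset u := by simpa using hy.2.1
  have hn : 8 ≤ Fintype.card V := by
    refine hcard.resolve_left fun h4 => ?_
    have h5 := Finset.card_le_univ (insert u (insert y (G.neighborFinset u)))
    rw [Finset.card_insert_of_notMem (by simp [hy.2.2.symm]), Finset.card_insert_of_notMem hyu,
      SimpleGraph.card_neighborFinset_eq_degree] at h5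
    omega
  set Z := Finset.univ.filter fun z => G.Adj x z ∧ G.Adj y z with hZ
  set B := insert u (insert y (G.neighborFinset u ∪ Z)) with hB
  have hBc : B.card ≤ 5 + Z.card := by
    have h1 := Finset.card_insert_le u (insert y (G.neighborFinset u ∪ Z))
    have h2 := Finset.card_insert_le y (G.neighborFinset u ∪ Z)
    have h3 := Finset.card_union_le (G.neighborFinset u) Z
    rw [SimpleGraph.card_neighborFinset_eq_degree] at h3
    rw [hB]
    omega
  have hcompl := B.card_add_card_compl
  have hZu : Z ⊆ (G.neighborFinset x).erase u := fun z hz => by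
    simp only [hZ, Finset.mem_filter, Finset.mem_univ, true_and] at hz
    simp only [Finset.mem_erase, SimpleGraph.mem_neighborFinset]
    exact ⟨by rintro rfl; exact hy.2.1 hz.2.symm, hz.1⟩
  have hux_mem : u ∈ G.neighborFinset x := by simpa using hx.1.symm
  by_cases e : G.Adj x y
  · have hZc : Z.card ≤ 1 := by
      have hsub : Z ⊆ ((G.neighborFinset x).erase u).erase y := fun z hz =>
        Finset.mem_erase.2 ⟨by rintro rfl; simp [hZ] at hz, hZu hz⟩
      have h1 := Finset.card_le_card hsub
      rw [Finset.card_erase_of_mem (by simp [hy.2.2, e]), Finset.card_erase_of_mem hux_mem,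
        SimpleGraph.card_neighborFinset_eq_degree] at h1
      have := hd x
      omega
    obtain ⟨a, ha, b, hb, hab⟩ := Finset.one_lt_card.1 (show 1 < Bᶜ.card by omega)
    rw [Finset.mem_compl] at ha hb
    have hZle : ∀ t, (Finset.univ.filter fun z => G.Adj t z ∧ G.Adj x z ∧ G.Adj y z).card ≤ 1 :=
      fun t => (Finset.card_le_card fun z hz => by
        simp only [hZ, Finset.mem_filter, Finset.mem_univ, true_and] at hz ⊢
        exact hz.2).trans hZc
    have hda := h.degree_le_of_notMem hx hy huy ha
    have hdb := h.degree_le_of_notMem hx hy huy hb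
    have hdab := hdef {a, b}
    rw [Finset.card_pair hab, Finset.sum_pair hab] at hdab
    have hZa := hZle a
    have hZb := hZle b
    obtain ⟨z, hz⟩ := Finset.card_pos.1 (show 0 <
      (Finset.univ.filter fun z => G.Adj a z ∧ G.Adj x z ∧ G.Adj y z).card by omega)
    obtain ⟨z', hz'⟩ := Finset.card_pos.1 (show 0 <
      (Finset.univ.filter fun z => G.Adj b z ∧ G.Adj x z ∧ G.Adj y z).card by omega)
    simp only [Finset.mem_filter, Finset.mem_univ, true_and] at hz hz'
    obtain rfl : z = z' := Finset.card_le_one.1 hZc z (by simp [hZ, hz]) z' (by simp [hZ, hz'])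
    have hsub : ({x, y, a, b} : Finset V) ⊆ G.neighborFinset z := fun t ht => by
      simp only [Finset.mem_insert, Finset.mem_singleton] at ht
      simp only [SimpleGraph.mem_neighborFinset]
      rcases ht with rfl | rfl | rfl | rfl
      · exact hz.2.1.symm
      · exact hz.2.2.symm
      · exact hz.1.symm
      · exact hz'.1.symm
    have h4 := Finset.card_le_card hsub
    have hmem : ∀ t ∉ B, t ≠ x ∧ t ≠ y := fun t ht =>
      ⟨by rintro rfl; exact ht (by simp [hB, hx.1]), by rintro rfl; exact ht (by simp [hB])⟩
    rw [Finset.card_eq_of_equiv_fin (n := 4) (by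
      refine Finset.equivFinOfCardEq ?_
      have := hmem a ha
      have := hmem b hb
      have := e.ne
      grind), SimpleGraph.card_neighborFinset_eq_degree] at h4
    have := hd z
    omega
  · obtain ⟨z, hxz, hyz⟩ := hxy.resolve_left e
    have hZc : Z.card ≤ 2 := by
      have h1 := Finset.card_le_card hZu
      rw [Finset.card_erase_of_mem hux_mem, SimpleGraph.card_neighborFinset_eq_degree] at h1
      have := hd x
      omega
    obtain ⟨a, ha⟩ := Finset.card_pos.1 (show 0 < Bᶜ.card by omega)
    rw [Finset.mem_compl] at ha
    have hda := h.degree_le_of_notMem hx hy huy ha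
    rw [Finset.card_eq_zero.2 (Finset.filter_eq_empty_iff.2 fun w _ hw => by
      rcases h.eq_or_eq_of_adj hx hy e hw.2.1 hw.2.2 hw.1.symm with rfl | rfl
      · exact ha (by simp [hB, hx.1])
      · exact ha (by simp [hB]))] at hda
    have haz : a ≠ z := by rintro rfl; exact ha (by simp [hB, hZ, hxz, hyz])
    have hdz : G.degree z ≤ 2 := by
      rw [← SimpleGraph.card_neighborFinset_eq_degree]
      refine (Finset.card_le_card fun s hs => ?_).trans (Finset.card_le_two (a := x) (b := y))
      simp only [SimpleGraph.mem_neighborFinset] at hs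
      simpa using h.eq_or_eq_of_adj hx hy e hxz hyz hs
    have hdaz := hdef {a, z}
    rw [Finset.card_pair haz, Finset.sum_pair haz] at hdaz
    omega

theorem false_of_sum_degree (h : Extremal G u v) (hu : 3 ≤ G.degree u) (hv : 3 ≤ G.degree v)
    (htop : ∀ t, t ≠ u → G.degree t ≤ G.degree v)
    (hcard : Fintype.card V = 4 ∨ 8 ≤ Fintype.card V)
    (hsum : 3 * Fintype.card V ≤ ∑ t, G.degree t + 2) : False := by
  obtain ⟨x₀, hx₀⟩ := h.exists_private hu
  obtain ⟨y₀, hy₀⟩ := h.symm.exists_private hv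
  have hconn := fun x y (hx : IsPrivate G u v x) (hy : IsPrivate G v u y) =>
    h.false_of_connected_privates hu htop hcard hsum hx hy
  have hle := h.sum_degree_le_of_leaves hx₀ hy₀
    (fun x hx b hb => by
      by_contra hbu
      by_cases hby : b = y₀
      · exact hconn x y₀ hx hy₀ (Or.inl (hby ▸ hb))
      · exact hconn x y₀ hx hy₀ (Or.inr ⟨b, hb, h.symm.adj_of_adj_private hy₀ hx hb hbu hby⟩))
    (fun y hy b hb => by
      by_contra hbv
      by_cases hbx : b = x₀
      · exact hconn x₀ y hx₀ hy (Or.inl (hbx ▸ hb).symm)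
      · exact hconn x₀ y hx₀ hy (Or.inr ⟨b, h.adj_of_adj_private hx₀ hy hb hbv hbx, hb⟩))
  omega

end Extremal

/-- Two vertices of largest degrees can be made adjacent without changing the degrees. -/
theorem exists_adj_of_degree_le (G : SimpleGraph V) {u v : V} (huv : u ≠ v)
    (hv : 0 < G.degree v) (hvu : G.degree v ≤ G.degree u)
    (htop : ∀ t, t ≠ u → G.degree t ≤ G.degree v) :
    ∃ G' : SimpleGraph V, (∀ t, G'.degree t = G.degree t) ∧ G'.Adj u v := by
  by_cases hadj : G.Adj u v
  · exact ⟨G, fun _ => rfl, hadj⟩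
  by_contra hno
  have hab : ∀ a b, G.Adj u a → G.Adj v b → a ≠ b → G.Adj a b := fun a b ha hb hne => by
    by_contra hn
    obtain ⟨G', hd, hG⟩ := exists_switch G ha hb hadj hn huv hne
    exact hno ⟨G', hd, (hG u v).2 (by simp)⟩
  have hsub : ∀ a, G.Adj u a → G.Adj v a := fun a ha => by
    by_contra hva
    have hss : insert u (G.neighborFinset v) ⊆ G.neighborFinset a := fun b hb => by
      simp only [Finset.mem_insert, SimpleGraph.mem_neighborFinset] at hb ⊢
      rcases hb with rfl | hb
      · exact ha.symm
      · exact hab a b ha hb (by rintro rfl; exact hva hb)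
    have := Finset.card_le_card hss
    rw [Finset.card_insert_of_notMem (by simpa using fun e => hadj e.symm),
      SimpleGraph.card_neighborFinset_eq_degree, SimpleGraph.card_neighborFinset_eq_degree] at this
    have := htop a ha.ne'
    omega
  obtain ⟨a, ha⟩ := (G.degree_pos_iff_exists_adj u).1 (hv.trans_le hvu)
  have hss : insert u (insert v ((G.neighborFinset v).erase a)) ⊆ G.neighborFinset a :=
    fun b hb => by
      simp only [Finset.mem_insert, Finset.mem_erase, SimpleGraph.mem_neighborFinset] at hb ⊢
      rcases hb with rfl | rfl | hb
      · exact ha.symm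
      · exact (hsub a ha).symm
      · exact hab a b ha hb.2 (Ne.symm hb.1)
  have := Finset.card_le_card hss
  rw [Finset.card_insert_of_notMem (by simp [huv, G.adj_comm v u, hadj]),
    Finset.card_insert_of_notMem (by simp),
    Finset.card_erase_of_mem (by simpa using hsub a ha),
    SimpleGraph.card_neighborFinset_eq_degree, SimpleGraph.card_neighborFinset_eq_degree] at this
  have := htop a ha.ne'
  omega

theorem exists_not_K4eFree (G : SimpleGraph V)
    (hcard : Fintype.card V = 4 ∨ 8 ≤ Fintype.card V)
    (hsum : 3 * Fintype.card V ≤ ∑ t, G.degree t + 2) :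
    ∃ G' : SimpleGraph V, (∀ t, G'.degree t = G.degree t) ∧ ¬ K4eFree G' := by
  by_contra! hfree
  obtain ⟨u, -, hu⟩ := Finset.exists_max_image (Finset.univ : Finset V) (fun t => G.degree t)
    (Finset.card_pos.1 (by rw [Finset.card_univ]; omega))
  obtain ⟨v, hvm, hv⟩ := Finset.exists_max_image (Finset.univ.erase u) (fun t => G.degree t)
    (Finset.card_pos.1 (by
      rw [Finset.card_erase_of_mem (Finset.mem_univ u), Finset.card_univ]; omega))
  have huv : u ≠ v := (Finset.ne_of_mem_erase hvm).symm
  have htop : ∀ t, t ≠ u → G.degree t ≤ G.degree v := fun t ht => hv t (by simp [ht])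
  have hvu : G.degree v ≤ G.degree u := hu v (Finset.mem_univ v)
  have hv3 : 3 ≤ G.degree v := by
    by_contra! hlt
    have h1 := Finset.add_sum_erase Finset.univ (fun t => G.degree t) (Finset.mem_univ u)
    have h2 : ∑ t ∈ Finset.univ.erase u, G.degree t ≤ (Finset.univ.erase u).card • 2 :=
      Finset.sum_le_card_nsmul _ _ _ fun t ht => by
        have := hv t ht
        omega
    rw [Finset.card_erase_of_mem (Finset.mem_univ u), Finset.card_univ, smul_eq_mul] at h2
    have := G.degree_lt_card_verts u
    omega
  obtain ⟨G₀, hd₀, hadj₀⟩ := exists_adj_of_degree_le G huv (by omega) hvu htop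
  let common := fun H : SimpleGraph V => Finset.univ.filter fun w => H.Adj u w ∧ H.Adj v w
  obtain ⟨G₁, ⟨hd₁, hadj₁⟩, hmax⟩ := Set.exists_max_image
    {H : SimpleGraph V | (∀ t, H.degree t = G.degree t) ∧ H.Adj u v} (fun H => (common H).card)
    (Set.toFinite _) ⟨G₀, hd₀, hadj₀⟩
  have hext : Extremal G₁ u v := ⟨hadj₁, hfree G₁ hd₁, fun G' hd hadj hsub a hua hva => by
    have hss : common G₁ ⊆ common G' := fun w hw => by
      simp only [common, Finset.mem_filter, Finset.mem_univ, true_and] at hw ⊢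
      exact hsub w hw.1 hw.2
    have heq := Finset.eq_of_subset_of_card_le hss
      (hmax G' ⟨fun t => (hd t).trans (hd₁ t), hadj⟩)
    have ha : a ∈ common G' := by simp [common, hua, hva]
    rw [← heq] at ha
    simpa [common] using ha⟩
  refine hext.false_of_sum_degree ?_ ?_ ?_ hcard ?_
  · rw [hd₁]; omega
  · rwa [hd₁]
  · simpa only [hd₁] using htop
  · simpa only [hd₁] using hsum

theorem containsSub_K4e_of_not_K4eFree {W : Type*} {G : SimpleGraph W} (h : ¬ K4eFree G) :
    ContainsSub G K4e := by
  unfold K4eFree at h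
  push Not at h
  obtain ⟨p, q, r, s, hpq, hpr, hqr, hps, hqs, hrs⟩ := h
  have hinj : Function.Injective ![r, s, p, q] := by
    intro i j
    fin_cases i <;> fin_cases j <;>
      simp [hrs, hrs.symm, hpq.ne, hpq.ne', hpr.ne, hpr.ne', hqr.ne, hqr.ne', hps.ne, hps.ne',
        hqs.ne, hqs.ne']
  refine ⟨⟨_, hinj⟩, fun a b => ?_⟩
  fin_cases a <;> fin_cases b <;>
    simp [K4e, hpq, hpq.symm, hpr, hpr.symm, hqr, hqr.symm, hps, hps.symm, hqs, hqs.symm]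

theorem stmt_1 (n : ℕ) (heven : Even n) (hn : n = 4 ∨ 8 ≤ n)
    (S : Fin n → ℕ) (hgr : Graphical S) (hsum : 3 * n - 2 ≤ ∑ i, S i) :
    ∃ G : SimpleGraph (Fin n), IsRealization S G ∧ ContainsSub G K4e := by
  obtain ⟨G, hG⟩ := hgr
  have hdeg : ∑ t, G.degree t = ∑ i, S i := by
    have := congrArg Multiset.sum hG
    rw [Finset.sum, Finset.sum, ← this]
  obtain ⟨G', hd, hfree⟩ := exists_not_K4eFree G (by simpa using hn) (by
    rw [hdeg, Fintype.card_fin]; omega)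
  refine ⟨G', ?_, containsSub_K4e_of_not_K4eFree hfree⟩
  unfold IsRealization at hG ⊢
  rw [← hG]
  refine Multiset.map_congr rfl fun t _ => ?_
  convert hd t
end
end

section
/- Every graphical sequence S of 6 nonnegative integers with sum σ(S) ≥ 16 either has a realization containing K₄−e as a subgraph, or S is the sequence (3,3,3,3,3,3). -/
open scoped Classical

noncomputable section

/-- At least five of the six pairs of a 4-element vertex set are edges. -/
abbrev SpansFive (a b c d e f : Bool) : Prop :=
  5 ≤ a.toNat + b.toNat + c.toNat + d.toNat + e.toNat + f.toNat

set_option synthInstance.maxSize 2000 in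
/-- The degree sequences of graphs on `a, …, f` with at least eight edges in which no four vertices
span five edges. The vertices are added one at a time, so that evaluation prunes early. -/
theorem degrees_of_forall_not_spansFive :
    ∀ ab ac bc ad bd cd : Bool, ¬ SpansFive ab ac ad bc bd cd →
    ∀ ae be ce de : Bool,
      ¬ SpansFive ab ac ae bc be ce →
      ¬ SpansFive ab ad ae bd be de →
      ¬ SpansFive ac ad ae cd ce de →
      ¬ SpansFive bc bd be cd ce de →
    ∀ af bf cf df ef : Bool,
      ¬ SpansFive ab ac af bc bf cf →
      ¬ SpansFive ab ad af bd bf df →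
      ¬ SpansFive ab ae af be bf ef →
      ¬ SpansFive ac ad af cd cf df →
      ¬ SpansFive ac ae af ce cf ef →
      ¬ SpansFive ad ae af de df ef →
      ¬ SpansFive bc bd bf cd cf df →
      ¬ SpansFive bc be bf ce cf ef →
      ¬ SpansFive bd be bf de df ef →
      ¬ SpansFive cd ce cf de df ef →
      ∀ m : Multiset ℕ, m = {
        ab.toNat + ac.toNat + ad.toNat + ae.toNat + af.toNat,
        ab.toNat + bc.toNat + bd.toNat + be.toNat + bf.toNat,
        ac.toNat + bc.toNat + cd.toNat + ce.toNat + cf.toNat,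
        ad.toNat + bd.toNat + cd.toNat + de.toNat + df.toNat,
        ae.toNat + be.toNat + ce.toNat + de.toNat + ef.toNat,
        af.toNat + bf.toNat + cf.toNat + df.toNat + ef.toNat} →
      16 ≤ m.sum →
      m = {4, 4, 2, 2, 2, 2} ∨ m = {4, 3, 3, 2, 2, 2} ∨ m = {3, 3, 3, 3, 2, 2} ∨
        m = {3, 3, 3, 3, 3, 3} := by
  simp only [forall_eq]
  decide +kernel

theorem containsSub_K4e_of_adj {V : Type*} {G : SimpleGraph V} {p q r s : V} (hpq : p ≠ q)
    (hpr : G.Adj p r) (hps : G.Adj p s) (hqr : G.Adj q r) (hqs : G.Adj q s) (hrs : G.Adj r s) :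
    ContainsSub G K4e := by
  refine ⟨⟨![p, q, r, s], ?_⟩, ?_⟩
  · have := hpr.ne
    have := hps.ne
    have := hqr.ne
    have := hqs.ne
    have := hrs.ne
    intro i j h
    fin_cases i <;> fin_cases j <;> simp_all
  · intro i j h
    change G.Adj (![p, q, r, s] i) (![p, q, r, s] j)
    fin_cases i <;> fin_cases j <;> simp_all [K4e, SimpleGraph.adj_comm]

theorem not_spansFive_of_not_containsSub {V : Type*} {G : SimpleGraph V} (hG : ¬ ContainsSub G K4e)
    {p q r s : V} (hpq : p ≠ q) (hpr : p ≠ r) (hps : p ≠ s) (hqr : q ≠ r) (hqs : q ≠ s)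
    (hrs : r ≠ s) :
    ¬ SpansFive (decide (G.Adj p q)) (decide (G.Adj p r)) (decide (G.Adj p s))
      (decide (G.Adj q r)) (decide (G.Adj q s)) (decide (G.Adj r s)) := by
  intro h
  have key {w x y z : V} (hwx : w ≠ x) (hwy : G.Adj w y) (hwz : G.Adj w z) (hxy : G.Adj x y)
      (hxz : G.Adj x z) (hyz : G.Adj y z) : False :=
    hG (containsSub_K4e_of_adj hwx hwy hwz hxy hxz hyz)
  by_cases h1 : G.Adj p q <;> by_cases h2 : G.Adj p r <;> by_cases h3 : G.Adj p s <;>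
    by_cases h4 : G.Adj q r <;> by_cases h5 : G.Adj q s <;> by_cases h6 : G.Adj r s <;>
    simp only [SpansFive, h1, h2, h3, h4, h5, h6, decide_true, decide_false, Bool.toNat_true,
      Bool.toNat_false] at h <;>
    first
    | omega
    | exact key hpq h2 h3 h4 h5 h6
    | exact key hpr h1 h3 h4.symm h6 h5
    | exact key hps h1 h2 h5.symm h6.symm h4
    | exact key hqr h1.symm h5 h2.symm h6 h3
    | exact key hqs h1.symm h4 h3.symm h6.symm h2
    | exact key hrs h2.symm h4.symm h3.symm h5.symm h1

theorem isRealization_iff {n : ℕ} {S : Fin n → ℕ} {G : SimpleGraph (Fin n)}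
    [DecidableRel G.Adj] :
    IsRealization S G ↔
      Multiset.map (fun v => G.degree v) Finset.univ.val = Multiset.map S Finset.univ.val := by
  unfold IsRealization
  convert Iff.rfl

theorem degree_eq_sum_decide (G : SimpleGraph (Fin 6)) [DecidableRel G.Adj] (v : Fin 6) :
    G.degree v = ∑ w, (decide (G.Adj v w)).toNat := by
  rw [← SimpleGraph.card_neighborFinset_eq_degree, SimpleGraph.neighborFinset_eq_filter,
    Finset.card_filter]
  refine Finset.sum_congr rfl fun w _ => ?_
  by_cases h : G.Adj v w <;> simp [h]

theorem degrees_of_not_containsSub {G : SimpleGraph (Fin 6)} (hG : ¬ ContainsSub G K4e)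
    {m : Multiset ℕ} (hm : Multiset.map (fun v => G.degree v) Finset.univ.val = m)
    (hsum : 16 ≤ m.sum) :
    m = {4, 4, 2, 2, 2, 2} ∨ m = {4, 3, 3, 2, 2, 2} ∨ m = {3, 3, 3, 3, 2, 2} ∨
      m = {3, 3, 3, 3, 3, 3} := by
  have hD {p q r s : Fin 6} := not_spansFive_of_not_containsSub hG (p := p) (q := q) (r := r) (s := s)
  refine degrees_of_forall_not_spansFive
    (decide (G.Adj 0 1)) (decide (G.Adj 0 2)) (decide (G.Adj 1 2))
    (decide (G.Adj 0 3)) (decide (G.Adj 1 3)) (decide (G.Adj 2 3))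
    (hD ?_ ?_ ?_ ?_ ?_ ?_)
    (decide (G.Adj 0 4)) (decide (G.Adj 1 4)) (decide (G.Adj 2 4)) (decide (G.Adj 3 4))
    (hD ?_ ?_ ?_ ?_ ?_ ?_) (hD ?_ ?_ ?_ ?_ ?_ ?_) (hD ?_ ?_ ?_ ?_ ?_ ?_) (hD ?_ ?_ ?_ ?_ ?_ ?_)
    (decide (G.Adj 0 5)) (decide (G.Adj 1 5)) (decide (G.Adj 2 5)) (decide (G.Adj 3 5)) (decide (G.Adj 4 5))
    (hD ?_ ?_ ?_ ?_ ?_ ?_) (hD ?_ ?_ ?_ ?_ ?_ ?_) (hD ?_ ?_ ?_ ?_ ?_ ?_) (hD ?_ ?_ ?_ ?_ ?_ ?_) (hD ?_ ?_ ?_ ?_ ?_ ?_)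
    (hD ?_ ?_ ?_ ?_ ?_ ?_) (hD ?_ ?_ ?_ ?_ ?_ ?_) (hD ?_ ?_ ?_ ?_ ?_ ?_) (hD ?_ ?_ ?_ ?_ ?_ ?_) (hD ?_ ?_ ?_ ?_ ?_ ?_)
    m ?_ hsum
  any_goals decide
  rw [← hm]
  simp only [degree_eq_sum_decide, Fin.sum_univ_six]
  simp [Fin.univ_val_map, List.ofFn_succ, G.adj_comm 1 0, G.adj_comm 2 0, G.adj_comm 2 1,
    G.adj_comm 3 0, G.adj_comm 3 1, G.adj_comm 3 2, G.adj_comm 4 0, G.adj_comm 4 1, G.adj_comm 4 2,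
    G.adj_comm 4 3, G.adj_comm 5 0, G.adj_comm 5 1, G.adj_comm 5 2, G.adj_comm 5 3, G.adj_comm 5 4]
  rfl

/-- The graph on six vertices whose edges are the listed pairs. -/
abbrev ofPairs (l : List (Fin 6 × Fin 6)) : SimpleGraph (Fin 6) :=
  SimpleGraph.fromRel fun i j => (i, j) ∈ l

theorem stmt_2 (S : Fin 6 → ℕ) (hgr : Graphical S) (hsum : 16 ≤ ∑ i, S i) :
    (∃ G : SimpleGraph (Fin 6), IsRealization S G ∧ ContainsSub G K4e) ∨
      (∀ i, S i = 3) := by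
  obtain ⟨G, hG⟩ := hgr
  by_cases hK : ContainsSub G K4e
  · exact .inl ⟨G, hG, hK⟩
  rcases degrees_of_not_containsSub hK (isRealization_iff.mp hG) hsum with h | h | h | h
  · refine .inl ⟨ofPairs [(0, 1), (0, 3), (0, 4), (0, 5), (1, 2), (1, 4), (1, 5), (2, 3)],
      isRealization_iff.mpr (h ▸ by decide), ?_⟩
    apply containsSub_K4e_of_adj (p := 4) (q := 5) (r := 0) (s := 1) <;> decide
  · refine .inl ⟨ofPairs [(0, 1), (0, 3), (0, 4), (0, 5), (1, 3), (1, 5), (2, 3), (2, 4)],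
      isRealization_iff.mpr (h ▸ by decide), ?_⟩
    apply containsSub_K4e_of_adj (p := 3) (q := 5) (r := 0) (s := 1) <;> decide
  · refine .inl ⟨ofPairs [(0, 3), (0, 4), (0, 5), (1, 2), (1, 5), (2, 3), (2, 4), (3, 4)],
      isRealization_iff.mpr (h ▸ by decide), ?_⟩
    apply containsSub_K4e_of_adj (p := 0) (q := 2) (r := 3) (s := 4) <;> decide
  · refine .inr fun i => ?_
    have hi : S i ∈ Multiset.map S Finset.univ.val := Multiset.mem_map_of_mem S (Finset.mem_univ i)
    simpa [h] using hi
end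
end

section
/- Every graphical sequence S of 6 nonnegative integers with sum σ(S) ≥ 20 has a realization containing K₄−e as a subgraph. -/
open scoped Classical

noncomputable section

theorem ContainsSub.of_common_neighbors {V : Type*} {G : SimpleGraph V} {a b u v : V}
    (hab : a ≠ b) (huv : G.Adj u v) (hau : G.Adj a u) (hav : G.Adj a v)
    (hbu : G.Adj b u) (hbv : G.Adj b v) : ContainsSub G K4e := by
  have hinj : Function.Injective ![a, b, u, v] := by
    have := huv.ne
    have := hau.ne
    have := hav.ne
    have := hbu.ne
    have := hbv.ne
    intro i j hij
    fin_cases i <;> fin_cases j <;> simp_all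
  refine ⟨⟨![a, b, u, v], hinj⟩, fun i j hij => ?_⟩
  fin_cases i <;> fin_cases j <;>
    simp_all [K4e, SimpleGraph.adj_comm]

/-- In a graph with no copy of `K₄ - e`, a vertex outside a triangle
has at most one neighbor in it. -/
theorem sum_adj_triangle_le_one {V : Type*} {G : SimpleGraph V}
    (hG : ¬ ContainsSub G K4e) {T : Finset V} (hT : G.IsNClique 3 T) {w : V} (hw : w ∉ T) :
    ∑ x ∈ T, (if G.Adj w x then 1 else 0) ≤ 1 := by
  obtain ⟨a, b, c, hab, hac, hbc, rfl⟩ := SimpleGraph.is3Clique_iff.1 hT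
  simp only [Finset.mem_insert, Finset.mem_singleton, not_or] at hw
  obtain ⟨hwa, hwb, hwc⟩ := hw
  have h₁ : ¬ (G.Adj w a ∧ G.Adj w b) := fun h =>
    hG (.of_common_neighbors hwc hab h.1 h.2 hac.symm hbc.symm)
  have h₂ : ¬ (G.Adj w a ∧ G.Adj w c) := fun h =>
    hG (.of_common_neighbors hwb hac h.1 h.2 hab.symm hbc)
  have h₃ : ¬ (G.Adj w b ∧ G.Adj w c) := fun h =>
    hG (.of_common_neighbors hwa hbc h.1 h.2 hab hac)
  rw [Finset.sum_insert (by simp [hab.ne, hac.ne]), Finset.sum_pair hbc.ne]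
  split_ifs <;> simp_all

/-- The number of neighbors of a member of `T` within `T` is at most `#T - 1`. -/
theorem sum_adj_le_card_sub_one {V : Type*} (G : SimpleGraph V) {T : Finset V} {v : V}
    (hv : v ∈ T) : ∑ w ∈ T, (if G.Adj v w then 1 else 0) ≤ T.card - 1 := by
  rw [← Finset.card_filter, ← Finset.card_erase_of_mem hv]
  refine Finset.card_le_card fun w hw => ?_
  rw [Finset.mem_filter] at hw
  exact Finset.mem_erase.2 ⟨hw.2.ne', hw.1⟩

theorem sum_degree_le_of_not_containsSub (G : SimpleGraph (Fin 6)) (hG : ¬ ContainsSub G K4e) :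
    ∑ v, G.degree v ≤ 18 := by
  by_cases hcf : G.CliqueFree 3
  · have h := hcf.card_edgeFinset_le (r := 2)
    norm_num at h
    rw [G.sum_degrees_eq_twice_card_edges]
    lia
  · simp only [SimpleGraph.CliqueFree, not_forall, not_not] at hcf
    obtain ⟨T, hT⟩ := hcf
    have hdeg (v : Fin 6) : G.degree v =
        ∑ w ∈ T, (if G.Adj v w then 1 else 0) + ∑ w ∈ Tᶜ, (if G.Adj v w then 1 else 0) := by
      rw [Finset.sum_add_sum_compl, ← G.card_neighborFinset_eq_degree,
        G.neighborFinset_eq_filter, Finset.card_filter]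
    have hcard : Tᶜ.card = 3 := by rw [Finset.card_compl, hT.card_eq, Fintype.card_fin]
    have hinside := Finset.sum_le_card_nsmul T _ _
      fun v hv => sum_adj_le_card_sub_one G hv
    have houtside := Finset.sum_le_card_nsmul Tᶜ _ _
      fun v hv => sum_adj_le_card_sub_one G hv
    have hcross := Finset.sum_le_card_nsmul Tᶜ _ _
      fun v hv => sum_adj_triangle_le_one hG hT (Finset.mem_compl.1 hv)
    have hswap : ∑ v ∈ T, ∑ w ∈ Tᶜ, (if G.Adj v w then 1 else 0) =
        ∑ v ∈ Tᶜ, ∑ w ∈ T, (if G.Adj v w then 1 else 0) := by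
      rw [Finset.sum_comm]
      simp only [G.adj_comm]
    rw [← Finset.sum_add_sum_compl T]
    simp only [hdeg, Finset.sum_add_distrib]
    simp only [hcard, hT.card_eq, smul_eq_mul] at hinside houtside hcross
    lia

theorem stmt_3 (S : Fin 6 → ℕ) (hgr : Graphical S) (hsum : 20 ≤ ∑ i, S i) :
    ∃ G : SimpleGraph (Fin 6), IsRealization S G ∧ ContainsSub G K4e := by
  obtain ⟨G, hG⟩ := hgr
  refine ⟨G, hG, ?_⟩
  by_contra hsub
  have hle := sum_degree_le_of_not_containsSub G hsub
  have heq : ∑ v, G.degree v = ∑ i, S i := by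
    simp only [Finset.sum_eq_multiset_sum]
    unfold IsRealization at hG
    convert! congrArg Multiset.sum hG
  lia
end
end

section
/- For every integer n ≥ 4 there exists a graphical sequence S of n nonnegative integers with σ(S) equal to 3n − 3 if n is odd and 3n − 4 if n is even, such that no realization of S contains K₄−e as a subgraph. (This gives the lower bound σ(K₄−e, n) ≥ 3n − 1 for n odd and σ(K₄−e, n) ≥ 3n − 2 for n even.) -/
open scoped Classical

noncomputable section

/-- The friendship graph on `Fin n`: the vertex `0` is joined to all others, and the vertices
`2k - 1`, `2k` are paired off; if `n` is even, the last vertex has no partner. -/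
def friendshipGraph (n : ℕ) : SimpleGraph (Fin n) where
  Adj i j := i ≠ j ∧ (i.val = 0 ∨ j.val = 0 ∨ (i.val + 1) / 2 = (j.val + 1) / 2)
  symm := ⟨fun i j h => ⟨h.1.symm, by have := h.2; omega⟩⟩
  loopless := ⟨fun i h => h.1 rfl⟩

/-- The degree sequence of `friendshipGraph n`. -/
def friendshipDegree (n : ℕ) (i : Fin n) : ℕ :=
  if i.val = 0 then n - 1 else if i.val + 1 = n ∧ Even n then 1 else 2

theorem degree_friendshipGraph (n : ℕ) (i : Fin n) :
    (friendshipGraph n).degree i = friendshipDegree n i := by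
  have hi := i.isLt
  rw [← SimpleGraph.card_neighborFinset_eq_degree, friendshipDegree]
  split_ifs with h0 hlast
  · have : (friendshipGraph n).neighborFinset i = Finset.univ.erase i := by
      ext j
      rw [SimpleGraph.mem_neighborFinset]
      simp [friendshipGraph, h0, eq_comm]
    simp [this]
  · have : (friendshipGraph n).neighborFinset i = {⟨0, by omega⟩} := by
      ext j
      obtain ⟨k, hk⟩ := hlast.2
      rw [SimpleGraph.mem_neighborFinset]
      simp only [friendshipGraph, Finset.mem_singleton,
        ne_eq, Fin.ext_iff]
      omega
    simp [this]
  · rw [Nat.even_iff] at hlast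
    have hmate : (if i.val % 2 = 1 then i.val + 1 else i.val - 1) < n := by split_ifs <;> omega
    have : (friendshipGraph n).neighborFinset i = {⟨0, by omega⟩, ⟨_, hmate⟩} := by
      ext j
      rw [SimpleGraph.mem_neighborFinset]
      simp only [friendshipGraph, Finset.mem_singleton,
        Finset.mem_insert, ne_eq, Fin.ext_iff]
      split_ifs <;> omega
    rw [this, Finset.card_pair]
    simp only [ne_eq, Fin.ext_iff]
    split_ifs <;> first | exact not_false | omega

theorem sum_friendshipDegree {n : ℕ} (hn : 2 ≤ n) :
    ∑ i, friendshipDegree n i = if Odd n then 3 * n - 3 else 3 * n - 4 := by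
  obtain ⟨m, rfl⟩ := Nat.exists_eq_add_of_le' hn
  rw [Fin.sum_univ_succ, Fin.sum_univ_castSucc]
  have hmid : ∀ i : Fin m, friendshipDegree (m + 2) i.castSucc.succ = 2 := by
    intro i
    have := i.isLt
    simp [friendshipDegree, this.ne]
  simp only [hmid]
  by_cases h : Odd (m + 2)
  · simp [friendshipDegree, h, Nat.not_even_iff_odd.2 h]
    omega
  · simp [friendshipDegree, h, Nat.not_odd_iff_even.1 h]
    omega

theorem IsRealization.card_filter_degree {n : ℕ} {S : Fin n → ℕ} {G : SimpleGraph (Fin n)}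
    (h : IsRealization S G) (p : ℕ → Prop) [DecidablePred p] :
    (Finset.univ.filter fun v => p (G.degree v)).card =
      (Finset.univ.filter fun v => p (S v)).card := by
  have := congrArg (Multiset.countP p) h
  simp only [Multiset.countP_map] at this
  rw [Finset.card_def, Finset.card_def, Finset.filter_val, Finset.filter_val]
  convert this

theorem ContainsSub.exists_two_degree_ge_three {V : Type*} [Fintype V] {G : SimpleGraph V}
    (h : ContainsSub G K4e) : ∃ u v, u ≠ v ∧ 3 ≤ G.degree u ∧ 3 ≤ G.degree v := by
  obtain ⟨f, hf⟩ := h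
  have key : ∀ a : Fin 4, (∀ b, b ≠ a → K4e.Adj a b) → 3 ≤ G.degree (f a) := by
    intro a ha
    rw [← SimpleGraph.card_neighborFinset_eq_degree]
    have hsub : (Finset.univ.erase a).map f ⊆ G.neighborFinset (f a) := by
      intro x hx
      obtain ⟨b, hb, rfl⟩ := Finset.mem_map.1 hx
      exact (G.mem_neighborFinset _ _).2 (hf _ _ (ha b (Finset.ne_of_mem_erase hb)))
    simpa using Finset.card_le_card hsub
  refine ⟨f 2, f 3, by simp, key 2 ?_, key 3 ?_⟩ <;>
    · intro b hb
      fin_cases b <;> simp_all [K4e]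

theorem stmt_14 (n : ℕ) (hn : 4 ≤ n) :
    ∃ S : Fin n → ℕ, Graphical S ∧
      (∑ i, S i = if Odd n then 3 * n - 3 else 3 * n - 4) ∧
      ∀ G : SimpleGraph (Fin n), IsRealization S G → ¬ ContainsSub G K4e := by
  refine ⟨friendshipDegree n, ⟨friendshipGraph n, ?_⟩, sum_friendshipDegree (by omega), ?_⟩
  · refine Multiset.map_congr rfl fun v _ => ?_
    convert degree_friendshipGraph n v
  · intro G hG hsub
    obtain ⟨u, v, huv, hu, hv⟩ := hsub.exists_two_degree_ge_three
    have hzero : ∀ i, 3 ≤ friendshipDegree n i → i.val = 0 := by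
      intro i hi
      unfold friendshipDegree at hi
      split_ifs at hi <;> omega
    refine (Finset.one_lt_card.2 ⟨u, by simpa using hu, v, by simpa using hv, huv⟩).not_ge
      ((hG.card_filter_degree (3 ≤ ·)).trans_le (Finset.card_le_one.2 fun a ha b hb => ?_))
    exact Fin.ext ((hzero a (by simpa using ha)).trans (hzero b (by simpa using hb)).symm)
end
end

section
/- Every graphical sequence S of 7 nonnegative integers with σ(S) ≥ 36 and with smallest term d₇ ≥ 1 has a realization containing the complete graph K₄ as a subgraph; consequently, every graphical sequence of 7 nonnegative integers with σ(S) ≥ 36 has a realization containing K₄−e as a subgraph. -/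
open scoped Classical

noncomputable section

/-- Deleting one endpoint of every non-edge leaves a clique. -/
theorem exists_isClique_card_add_card_edgeFinset_compl_ge {V : Type*} [Fintype V]
    (G : SimpleGraph V) :
    ∃ s : Finset V, G.IsClique s ∧ Fintype.card V ≤ s.card + Gᶜ.edgeFinset.card := by
  refine ⟨(Gᶜ.edgeFinset.image fun e => e.out.1)ᶜ, ?_, ?_⟩
  · intro a ha b hb hab
    by_contra hadj
    have he : s(a, b) ∈ Gᶜ.edgeFinset := by
      simp [SimpleGraph.mem_edgeFinset, hab, hadj]
    have hmem : s(a, b).out.1 ∈ Gᶜ.edgeFinset.image fun e => e.out.1 :=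
      Finset.mem_image_of_mem _ he
    rcases Sym2.mem_iff.1 (Sym2.out_fst_mem s(a, b)) with h | h <;> rw [h] at hmem
    · exact (Finset.mem_compl.1 (Finset.mem_coe.1 ha)) hmem
    · exact (Finset.mem_compl.1 (Finset.mem_coe.1 hb)) hmem
  · have h := Finset.card_image_le (s := Gᶜ.edgeFinset) (f := fun e => e.out.1)
    rw [Finset.card_compl]
    omega

theorem sum_degree_add_two_mul_card_edgeFinset_compl {V : Type*} [Fintype V]
    (G : SimpleGraph V) :
    ∑ v, G.degree v + 2 * Gᶜ.edgeFinset.card = Fintype.card V * (Fintype.card V - 1) := by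
  rw [← SimpleGraph.sum_degrees_eq_twice_card_edges, ← Finset.sum_add_distrib,
    Finset.sum_congr rfl (g := fun _ => Fintype.card V - 1), Finset.sum_const, smul_eq_mul,
    Finset.card_univ]
  intro v _
  rw [SimpleGraph.degree_compl]
  have := G.degree_lt_card_verts v
  omega

theorem IsRealization.sum_degree {n : ℕ} {S : Fin n → ℕ} {G : SimpleGraph (Fin n)}
    (h : IsRealization S G) : ∑ v, G.degree v = ∑ i, S i := by
  simp only [Finset.sum_eq_multiset_sum]
  convert congrArg Multiset.sum h

theorem ContainsSub.mono_right {W V : Type*} {G : SimpleGraph V} {H K : SimpleGraph W}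
    (hHK : H ≤ K) (h : ContainsSub G K) : ContainsSub G H :=
  let ⟨f, hf⟩ := h
  ⟨f, fun a b hab => hf a b (hHK hab)⟩

theorem containsSub_top_of_isClique {V : Type*} {G : SimpleGraph V} {s : Finset V} {k : ℕ}
    (hs : G.IsClique s) (hk : k ≤ s.card) : ContainsSub G (⊤ : SimpleGraph (Fin k)) := by
  let f : Fin k ↪ V := ((Fin.castLEEmb hk).trans s.equivFin.symm.toEmbedding).trans
    (Function.Embedding.subtype _)
  exact ⟨f, fun a b hab => hs (s.equivFin.symm _).2 (s.equivFin.symm _).2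
    (f.injective.ne hab.ne)⟩

theorem IsRealization.containsSub_top {S : Fin 7 → ℕ} {G : SimpleGraph (Fin 7)}
    (h : IsRealization S G) (hS : 36 ≤ ∑ i, S i) :
    ContainsSub G (⊤ : SimpleGraph (Fin 4)) := by
  obtain ⟨s, hs, hcard⟩ := exists_isClique_card_add_card_edgeFinset_compl_ge G
  have hsum := sum_degree_add_two_mul_card_edgeFinset_compl G
  rw [h.sum_degree] at hsum
  rw [Fintype.card_fin] at hsum hcard
  exact containsSub_top_of_isClique hs (by omega)

theorem stmt_17 :
    (∀ S : Fin 7 → ℕ, Antitone S → Graphical S → 36 ≤ ∑ i, S i → 1 ≤ S 6 →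
        ∃ G : SimpleGraph (Fin 7), IsRealization S G ∧
          ContainsSub G (⊤ : SimpleGraph (Fin 4))) ∧
    (∀ S : Fin 7 → ℕ, Graphical S → 36 ≤ ∑ i, S i →
        ∃ G : SimpleGraph (Fin 7), IsRealization S G ∧ ContainsSub G K4e) := by
  refine ⟨?_, ?_⟩
  · rintro S - ⟨G, hG⟩ hS -
    exact ⟨G, hG, hG.containsSub_top hS⟩
  · rintro S ⟨G, hG⟩ hS
    exact ⟨G, hG, (hG.containsSub_top hS).mono_right le_top⟩
end
end
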